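/- Let d ∈ ℤ_{>0} and let X = [[z√ε, u√ε],[v√ε, z√ε]] with z, u, v ∈ F, ν(z) ≥ −d and ν(v) > ν(u) = −d. Let H = T(X)·J_d (the set of products t·j with t ∈ T(X), j ∈ J_d, which is a subgroup of K), and suppose Ψ′ : H → ℂ^× is a group homomorphism whose restriction to J_d equals Ψ_X. Then the space S = { f : K → ℂ : f(hk) = Ψ′(h)·f(k) for all h ∈ H, k ∈ K }, with K acting by right translation (g·f)(k) = f(kg), is an irreducible K-representation of complex dimension (q²−1)·q^{d−1}, on which K_{d+1} acts trivially while K_d does not act trivially. -/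

import Mathlib

open Matrix

noncomputable section

/-- A 2×2 matrix over `E`. -/
abbrev Mat (E : Type) := Matrix (Fin 2) (Fin 2) E

/-- The context: `E/F` is the unramified quadratic extension of a finite extension `F` of
`ℚ_p` (`p` odd), encoded via the Galois involution `sig` (whose fixed field is `F`),
the valuation `nu` (normalized by `nu ϖ = 1` for a uniformizer `ϖ` of `F`),
a square root `sqeps` of a non-square unit `eps = sqeps^2` of `O_F`, the residue-field
cardinality `q` of `F`, and an additive character `psi'` of `F` trivial on `p_F` and
nontrivial on `O_F`. -/
structure USetting (E : Type) [Field E] where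
  sig : E →+* E
  nu : E → WithTop ℤ
  sqeps : E
  pi : E
  q : ℕ
  psi' : E → ℂ
  sig_invol : ∀ x, sig (sig x) = x
  sig_ne : ∃ x, sig x ≠ x
  nu_eq_top : ∀ x, nu x = ⊤ ↔ x = 0
  nu_mul : ∀ x y, nu (x * y) = nu x + nu y
  nu_add : ∀ x y, min (nu x) (nu y) ≤ nu (x + y)
  nu_sig : ∀ x, nu (sig x) = nu x
  nu_pi : nu pi = 1
  sig_pi : sig pi = pi
  sig_sqeps : sig sqeps = - sqeps
  nu_sqeps : nu sqeps = 0
  eps_not_square : ∀ y, sig y = y → y * y ≠ sqeps * sqeps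
  gen : ∀ x : E, ∃ a b, sig a = a ∧ sig b = b ∧ x = a + b * sqeps
  nu_two : nu 2 = 0
  charzero : ∀ n : ℕ, (n : E) = 0 → n = 0
  complete : ∀ f : ℕ → E, (∀ n : ℕ, ((n : ℤ) : WithTop ℤ) ≤ nu (f (n + 1) - f n)) →
    ∃ L, ∀ n : ℕ, ((n : ℤ) : WithTop ℤ) ≤ nu (L - f n)
  res_card : ∃ R : Finset E, R.card = q ∧ (∀ x ∈ R, sig x = x ∧ 0 ≤ nu x) ∧
    ∀ y : E, sig y = y → 0 ≤ nu y → ∃! x, x ∈ R ∧ 1 ≤ nu (y - x)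
  psi'_mul : ∀ x y, sig x = x → sig y = y → psi' (x + y) = psi' x * psi' y
  psi'_ne : ∀ x, sig x = x → psi' x ≠ 0
  psi'_triv : ∀ x, sig x = x → 1 ≤ nu x → psi' x = 1
  psi'_nontriv : ∃ x, sig x = x ∧ 0 ≤ nu x ∧ psi' x ≠ 1

variable {E : Type} [Field E]

/-- The matrix `w₀ = [[0,1],[1,0]]`. -/
def w0 (E : Type) [Field E] : Mat E := !![0, 1; 1, 0]

/-- `G = U(1,1)(F)`. -/
def Gset (S : USetting E) : Set (Mat E) :=
  {g | (g.map ⇑S.sig)ᵀ * w0 E * g = w0 E}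

/-- `K = G ∩ GL₂(O_E)`: entries in `O_E` and determinant in `O_E^×`. -/
def Kset (S : USetting E) : Set (Mat E) :=
  {g | g ∈ Gset S ∧ (∀ i j, 0 ≤ S.nu (g i j)) ∧ S.nu g.det = 0}

/-- The congruence filtration subgroup `K_n` (for `n ≥ 1`; `K_0 = K` as a set). -/
def Kfil (S : USetting E) (n : ℤ) : Set (Mat E) :=
  {g | g ∈ Kset S ∧ ∀ i j, (n : WithTop ℤ) ≤ S.nu ((g - 1) i j)}

/-- `𝓑 = B ∩ K`, the upper triangular matrices in `K`. -/
def Bcal (S : USetting E) : Set (Mat E) := {g | g ∈ Kset S ∧ g 1 0 = 0}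

/-- `E^1`, the norm-one elements of `E`. -/
def E1set (S : USetting E) : Set E := {x | x * S.sig x = 1}

/-- `O_F^×` as a subset of `E`. -/
def OFunits (S : USetting E) : Set E := {x | S.sig x = x ∧ S.nu x = 0}

/-- `O_E^×` as a subset of `E`. -/
def OEunits (S : USetting E) : Set E := {x | S.nu x = 0}

/-- A character of `E^×`, encoded as a function `E → ℂ` multiplicative and
nonvanishing on nonzero elements. -/
def IsChar (χ : E → ℂ) : Prop :=
  (∀ x y : E, x ≠ 0 → y ≠ 0 → χ (x * y) = χ x * χ y) ∧ ∀ x : E, x ≠ 0 → χ x ≠ 0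

/-- A group homomorphism `E^1 → ℂ^×`, encoded as a function `E → ℂ`. -/
def IsE1Hom (S : USetting E) (φ : E → ℂ) : Prop :=
  (∀ x ∈ E1set S, ∀ y ∈ E1set S, φ (x * y) = φ x * φ y) ∧ ∀ x ∈ E1set S, φ x ≠ 0

/-- A homomorphism into `ℂ^×` on a subset of matrices. -/
def IsHomOn (A : Set (Mat E)) (Ψ : Mat E → ℂ) : Prop :=
  (∀ x ∈ A, ∀ y ∈ A, Ψ (x * y) = Ψ x * Ψ y) ∧ ∀ x ∈ A, Ψ x ≠ 0

/-- `1 + p_E^n`. -/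
def onePE (S : USetting E) (n : ℤ) : Set E := {x | (n : WithTop ℤ) ≤ S.nu (x - 1)}

/-- `1 + p_F^n`. -/
def onePF (S : USetting E) (n : ℤ) : Set E :=
  {x | S.sig x = x ∧ (n : WithTop ℤ) ≤ S.nu (x - 1)}

/-- `χ` is trivial on a set. -/
def TrivOn (χ : E → ℂ) (s : Set E) : Prop := ∀ x ∈ s, χ x = 1

/-- `χ` has depth `r`: trivial on `1+p_E^{r+1}` and (if `r ≥ 1`) nontrivial on `1+p_E^r`. -/
def HasDepth (S : USetting E) (χ : E → ℂ) (r : ℕ) : Prop :=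
  TrivOn χ (onePE S ((r : ℤ) + 1)) ∧ (r = 0 ∨ ¬ TrivOn χ (onePE S (r : ℤ)))

/-- `χ` has true depth `r`: the depth of its restriction to `F^×` is `r`. -/
def HasTrueDepth (S : USetting E) (χ : E → ℂ) (r : ℕ) : Prop :=
  TrivOn χ (onePF S ((r : ℤ) + 1)) ∧ (r = 0 ∨ ¬ TrivOn χ (onePF S (r : ℤ)))

/-- `χ` has minimal depth `r`: its depth and true depth both equal `r`. -/
def MinDepth (S : USetting E) (χ : E → ℂ) (r : ℕ) : Prop :=
  HasDepth S χ r ∧ HasTrueDepth S χ r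

/-- Right translation action on functions. -/
def rho (g : Mat E) : (Mat E → ℂ) →ₗ[ℂ] (Mat E → ℂ) where
  toFun f := fun k => f (k * g)
  map_add' _ _ := rfl
  map_smul' _ _ := rfl

/-- The space `V_χ^{K_n}`: functions on `K` (extended by zero off `K`) satisfying
`f(bk) = χ(b₁₁) f(k)` for `b ∈ 𝓑` and right `K_n`-invariance. -/
def Vsp (S : USetting E) (χ : E → ℂ) (n : ℤ) : Submodule ℂ (Mat E → ℂ) where
  carrier := {f | (∀ x, x ∉ Kset S → f x = 0) ∧
    (∀ b ∈ Bcal S, ∀ k ∈ Kset S, f (b * k) = χ (b 0 0) * f k) ∧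
    (∀ k ∈ Kset S, ∀ g ∈ Kfil S n, f (k * g) = f k)}
  add_mem' := by
    rintro f g ⟨hf0, hf1, hf2⟩ ⟨hg0, hg1, hg2⟩
    refine ⟨fun x hx => ?_, fun b hb k hk => ?_, fun k hk g' hg' => ?_⟩
    · simp [hf0 x hx, hg0 x hx]
    · simp only [Pi.add_apply, hf1 b hb k hk, hg1 b hb k hk]; ring
    · simp only [Pi.add_apply, hf2 k hk g' hg', hg2 k hk g' hg']
  zero_mem' := by
    refine ⟨fun x _ => rfl, fun b _ k _ => by simp, fun k _ g _ => rfl⟩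
  smul_mem' := by
    rintro c f ⟨hf0, hf1, hf2⟩
    refine ⟨fun x hx => ?_, fun b hb k hk => ?_, fun k hk g' hg' => ?_⟩
    · simp [hf0 x hx]
    · simp only [Pi.smul_apply, hf1 b hb k hk, smul_eq_mul]; ring
    · simp only [Pi.smul_apply, hf2 k hk g' hg']

/-- The space of the representation induced from a character `Ψ` of a subgroup `H ⊆ K`:
functions on `K` (extended by zero) with `f(hk) = Ψ(h) f(k)`. -/
def IndSp (S : USetting E) (H : Set (Mat E)) (Ψ : Mat E → ℂ) : Submodule ℂ (Mat E → ℂ) where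
  carrier := {f | (∀ x, x ∉ Kset S → f x = 0) ∧
    ∀ h ∈ H, ∀ k ∈ Kset S, f (h * k) = Ψ h * f k}
  add_mem' := by
    rintro f g ⟨hf0, hf1⟩ ⟨hg0, hg1⟩
    refine ⟨fun x hx => ?_, fun h hh k hk => ?_⟩
    · simp [hf0 x hx, hg0 x hx]
    · simp only [Pi.add_apply, hf1 h hh k hk, hg1 h hh k hk]; ring
  zero_mem' := ⟨fun x _ => rfl, fun h _ k _ => by simp⟩
  smul_mem' := by
    rintro c f ⟨hf0, hf1⟩
    refine ⟨fun x hx => ?_, fun h hh k hk => ?_⟩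
    · simp [hf0 x hx]
    · simp only [Pi.smul_apply, hf1 h hh k hk, smul_eq_mul]; ring

/-- The functions constant on `K` and zero off `K`. -/
def ConstSub (S : USetting E) : Submodule ℂ (Mat E → ℂ) where
  carrier := {f | (∀ x, x ∉ Kset S → f x = 0) ∧ ∃ c : ℂ, ∀ k ∈ Kset S, f k = c}
  add_mem' := by
    rintro f g ⟨hf0, c, hc⟩ ⟨hg0, c', hc'⟩
    exact ⟨fun x hx => by simp [hf0 x hx, hg0 x hx],
      c + c', fun k hk => by simp [hc k hk, hc' k hk]⟩
  zero_mem' := ⟨fun x _ => rfl, 0, fun _ _ => rfl⟩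
  smul_mem' := by
    rintro a f ⟨hf0, c, hc⟩
    exact ⟨fun x hx => by simp [hf0 x hx], a * c, fun k hk => by simp [hc k hk]⟩

/-- A subspace is `K`-invariant. -/
def KInvariant (S : USetting E) (W : Submodule ℂ (Mat E → ℂ)) : Prop :=
  ∀ g ∈ Kset S, ∀ f ∈ W, rho g f ∈ W

/-- A subset `A ⊆ K` acts trivially on `W`. -/
def ActsTrivially (S : USetting E) (A : Set (Mat E)) (W : Submodule ℂ (Mat E → ℂ)) : Prop :=
  ∀ g ∈ A, ∀ f ∈ W, rho g f = f

/-- `W` is an irreducible representation of `K`. -/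
def IsIrredRep (S : USetting E) (W : Submodule ℂ (Mat E → ℂ)) : Prop :=
  W ≠ ⊥ ∧ KInvariant S W ∧
    ∀ U : Submodule ℂ (Mat E → ℂ), U ≤ W → KInvariant S U → U = ⊥ ∨ U = W

/-- `V` and `W` are isomorphic as representations of `K`. -/
def RepIso (S : USetting E) (V W : Submodule ℂ (Mat E → ℂ)) : Prop :=
  ∃ e : (Mat E → ℂ) →ₗ[ℂ] (Mat E → ℂ), Set.BijOn ⇑e ↑V ↑W ∧
    ∀ g ∈ Kset S, ∀ f ∈ V, e (rho g f) = rho g (e f)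

/-- The space of `ℂ`-linear endomorphisms of `V` commuting with the right-translation
action of `K`, realized inside the function space `↥V → ↥V`. -/
def Commutant (S : USetting E) (V : Submodule ℂ (Mat E → ℂ)) :
    Submodule ℂ (↥V → ↥V) where
  carrier := {T | (∀ x y : ↥V, T (x + y) = T x + T y) ∧
    (∀ (c : ℂ) (x : ↥V), T (c • x) = c • T x) ∧
    ∀ g ∈ Kset S, ∀ f : ↥V, ∀ h : rho g (f : Mat E → ℂ) ∈ V,
      ((T ⟨rho g (f : Mat E → ℂ), h⟩ : ↥V) : Mat E → ℂ) = rho g ((T f : ↥V) : Mat E → ℂ)}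
  add_mem' := by
    rintro T T' ⟨hT1, hT2, hT3⟩ ⟨hT1', hT2', hT3'⟩
    refine ⟨fun x y => ?_, fun c x => ?_, fun g hg f h => ?_⟩
    · simp only [Pi.add_apply, hT1 x y, hT1' x y]; abel
    · simp only [Pi.add_apply, hT2 c x, hT2' c x, smul_add]
    · simp only [Pi.add_apply, Submodule.coe_add, hT3 g hg f h, hT3' g hg f h, map_add]
  zero_mem' := by
    refine ⟨fun x y => by simp, fun c x => by simp, fun g hg f h => by simp⟩
  smul_mem' := by
    rintro c T ⟨hT1, hT2, hT3⟩
    refine ⟨fun x y => ?_, fun a x => ?_, fun g hg f h => ?_⟩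
    · simp only [Pi.smul_apply, hT1 x y, smul_add]
    · simp only [Pi.smul_apply, hT2 a x, smul_comm c a]
    · simp only [Pi.smul_apply, Submodule.coe_smul, hT3 g hg f h, _root_.map_smul]

/-- The additive character `ψ` of `E`, `ψ(x) = ψ'((x + σ(x))/2)`. -/
def psiE (S : USetting E) (x : E) : ℂ := S.psi' ((x + S.sig x) / 2)

/-- `Ψ_Y(g) = ψ(Tr(Y (g − 1)))`. -/
def PsiC (S : USetting E) (Y g : Mat E) : ℂ := psiE S ((Y * (g - 1)).trace)

/-- The Lie algebra `𝔤 = 𝔲(1,1)(F)`. -/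
def gfrak (S : USetting E) : Set (Mat E) :=
  {Y | (Y.map ⇑S.sig)ᵀ * w0 E + w0 E * Y = 0}

/-- The lattice `𝔨_s` of the Lie algebra, where `c = ⌈s⌉`. -/
def kfrakC (S : USetting E) (c : ℤ) : Set (Mat E) :=
  {Y | Y ∈ gfrak S ∧ (c : WithTop ℤ) ≤ S.nu (Y 0 0) ∧ (c : WithTop ℤ) ≤ S.nu (Y 1 1) ∧
    (∃ t, S.sig t = t ∧ (c : WithTop ℤ) ≤ S.nu t ∧ Y 0 1 = S.sqeps * t) ∧
    (∃ t, S.sig t = t ∧ (c : WithTop ℤ) ≤ S.nu t ∧ Y 1 0 = S.sqeps * t)}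

/-- The group `J_d`. -/
def Jgrp (S : USetting E) (d : ℕ) : Set (Mat E) :=
  {g | g ∈ Kset S ∧ ((((d + 1) / 2 : ℕ) : WithTop ℤ) ≤ S.nu (g 0 0 - 1)) ∧
    ((((d + 1) / 2 : ℕ) : WithTop ℤ) ≤ S.nu (g 0 1)) ∧
    ((((d + 1) / 2 : ℕ) : WithTop ℤ) ≤ S.nu (g 1 1 - 1)) ∧
    (((d / 2 + 1 : ℕ) : WithTop ℤ) ≤ S.nu (g 1 0))}

/-- The centralizer `T(X)` in `K` of `X = [[z√ε, u√ε],[v√ε, z√ε]]`. -/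
def TXset (S : USetting E) (u v : E) : Set (Mat E) :=
  {m | m ∈ Kset S ∧ m 1 1 = m 0 0 ∧ m 1 0 = m 0 1 * (u⁻¹ * v)}

/-- The center `Z` of `G`, identified with scalar matrices with entries in `E^1`. -/
def Zset (S : USetting E) : Set (Mat E) := {m | ∃ z ∈ E1set S, m = z • (1 : Mat E)}

/-- `𝒰 = U ∩ K`. -/
def Uset (S : USetting E) : Set (Mat E) :=
  {m | ∃ b, S.sig b = b ∧ 0 ≤ S.nu b ∧ m = !![1, b * S.sqeps; 0, 1]}

/-- The set of products `T(X)·J_d`. -/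
def TXJ (S : USetting E) (u v : E) (d : ℕ) : Set (Mat E) :=
  {x | ∃ t ∈ TXset S u v, ∃ j ∈ Jgrp S d, x = t * j}

/-- The set of products `Z·𝒰·J_d`. -/
def ZUJ (S : USetting E) (d : ℕ) : Set (Mat E) :=
  {x | ∃ z ∈ Zset S, ∃ m ∈ Uset S, ∃ j ∈ Jgrp S d, x = z * m * j}

/-- `X = [[z√ε, u√ε],[v√ε, z√ε]]`. -/
def Xzuv (S : USetting E) (z u v : E) : Mat E :=
  !![z * S.sqeps, u * S.sqeps; v * S.sqeps, z * S.sqeps]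

/-- The nilpotent element `X_δ = [[0, δ√ε],[0,0]]`. -/
def Xdelta (S : USetting E) (δ : E) : Mat E := !![0, δ * S.sqeps; 0, 0]

/-- `W` is a `K`-invariant complement of `V_χ^{K_d}` inside `V_χ^{K_{d+1}}`. -/
def Wcompl (S : USetting E) (χ : E → ℂ) (d : ℕ) (W : Submodule ℂ (Mat E → ℂ)) : Prop :=
  W ≤ Vsp S χ ((d : ℤ) + 1) ∧ KInvariant S W ∧
    Vsp S χ (d : ℤ) ⊓ W = ⊥ ∧ Vsp S χ (d : ℤ) ⊔ W = Vsp S χ ((d : ℤ) + 1)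

section InducedCharacter

variable {G : Type*} [Group G]

/-- The space of functions on `G` transforming under left translation by `H` through `χ`. -/
def indChar (H : Subgroup G) (χ : G → ℂ) : Submodule ℂ (G → ℂ) where
  carrier := {f | ∀ h ∈ H, ∀ k, f (h * k) = χ h * f k}
  add_mem' := by
    intro f g hf hg h hh k
    simp only [Pi.add_apply, hf h hh k, hg h hh k, mul_add]
  zero_mem' := fun h _ k => by simp
  smul_mem' := by
    intro c f hf h hh k
    simp only [Pi.smul_apply, hf h hh k, smul_eq_mul]
    ring

/-- Right translation by `g` on functions on `G`. -/
def rightTranslate (g : G) (f : G → ℂ) : G → ℂ := fun k => f (k * g)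

variable {H J N : Subgroup G} {χ : G → ℂ}

theorem char_one_of_mul (hmul : ∀ x ∈ H, ∀ y ∈ H, χ (x * y) = χ x * χ y)
    (hne : ∀ x ∈ H, χ x ≠ 0) : χ 1 = 1 := by
  have h := hmul 1 H.one_mem 1 H.one_mem
  rw [one_mul] at h
  exact (mul_eq_left₀ (hne 1 H.one_mem)).1 h.symm

/-- The dimension of an induced character is the number of cosets. -/
theorem finrank_indChar {ι : Type*} [Fintype ι] (s : ι → G) (hs : ∀ g, ∃! i, g * s i ∈ H)
    (hmul : ∀ x ∈ H, ∀ y ∈ H, χ (x * y) = χ x * χ y) (hne : ∀ x ∈ H, χ x ≠ 0) :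
    Module.finrank ℂ (indChar H χ) = Fintype.card ι := by
  have h1 := char_one_of_mul hmul hne
  let T : indChar H χ →ₗ[ℂ] (ι → ℂ) :=
    { toFun := fun f i => f.1 (s i)⁻¹
      map_add' := fun _ _ => rfl
      map_smul' := fun _ _ => rfl }
  have hT : Function.Bijective T := by
    constructor
    · rw [injective_iff_map_eq_zero]
      intro f hf
      ext g
      obtain ⟨i, hi, -⟩ := hs g
      have h2 := f.2 _ hi (s i)⁻¹
      have h3 : f.1 (s i)⁻¹ = 0 := congrFun hf i
      rw [h3, mul_zero, mul_inv_cancel_right] at h2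
      exact h2
    · intro c
      choose idx hidx huniq using hs
      refine ⟨⟨fun g => χ (g * s (idx g)) * c (idx g), ?_⟩, ?_⟩
      · intro h hh k
        have e : idx (h * k) = idx k := by
          refine huniq k _ ?_
          have h2 : h * k * s (idx (h * k)) ∈ H := hidx (h * k)
          rw [mul_assoc] at h2
          exact (H.mul_mem_cancel_left hh).1 h2
        simp only [e]
        rw [mul_assoc h k, hmul h hh _ (hidx k), mul_assoc]
      · funext i
        have e : i = idx (s i)⁻¹ := huniq (s i)⁻¹ i (by simp [H.one_mem])
        change χ ((s i)⁻¹ * s (idx (s i)⁻¹)) * c (idx (s i)⁻¹) = c i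
        rw [← e, inv_mul_cancel, h1, one_mul]
  rw [(LinearEquiv.ofBijective T hT).finrank_eq, Module.finrank_fintype_fun_eq_card]

/-- A `(J, χ)`-equivariant vector inside any translation-invariant subspace,
obtained by averaging over the finite quotient `J / N`. -/
theorem exists_equivariant_mem (hNJ : N ≤ J) (hJH : J ≤ H) [Finite (G ⧸ N)]
    (hmul : ∀ x ∈ H, ∀ y ∈ H, χ (x * y) = χ x * χ y) (hne : ∀ x ∈ H, χ x ≠ 0)
    (hχN : ∀ x ∈ N, χ x = 1)
    {U : Submodule ℂ (G → ℂ)} (hUN : ∀ f ∈ U, ∀ n ∈ N, ∀ k, f (k * n) = f k)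
    (hU : U ≤ indChar H χ) (hinv : ∀ g, ∀ f ∈ U, rightTranslate g f ∈ U) (hU0 : U ≠ ⊥) :
    ∃ f ∈ U, f 1 ≠ 0 ∧ ∀ j ∈ J, ∀ k, f (k * j) = χ j * f k := by
  classical
  obtain ⟨f₀, hf₀U, hf₀⟩ := (Submodule.ne_bot_iff U).1 hU0
  obtain ⟨g, hg⟩ := Function.ne_iff.1 hf₀
  set f := rightTranslate g f₀ with hf
  have hfU : f ∈ U := hinv g f₀ hf₀U
  have hf1 : f 1 ≠ 0 := by simpa [hf, rightTranslate] using hg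
  have hfin : Finite (J ⧸ N.subgroupOf J) := by
    have : N.FiniteIndex := Subgroup.finiteIndex_of_finite_quotient
    have : (N.subgroupOf J).FiniteIndex := inferInstance
    exact Subgroup.finite_quotient_of_finiteIndex
  have := Fintype.ofFinite (J ⧸ N.subgroupOf J)
  -- the summand at `k` descends to the quotient
  let F : G → (J ⧸ N.subgroupOf J) → ℂ := fun k x =>
    Quotient.liftOn' x (fun j => (χ j)⁻¹ * f (k * j)) (by
      intro a b hab
      rw [QuotientGroup.leftRel_apply, Subgroup.mem_subgroupOf] at hab
      have e : (b : G) = a * ((a⁻¹ * b : J) : G) := by simp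
      have h2 : χ (b : G) = χ (a : G) := by
        rw [e, hmul _ (hJH a.2) _ (hJH (hNJ hab)), hχN _ hab, mul_one]
      have h3 : f (k * (b : G)) = f (k * a) := by
        rw [e, ← mul_assoc]
        exact hUN f hfU _ hab _
      simp only [h2, h3])
  have hF : ∀ k (j : J), F k (j : J ⧸ N.subgroupOf J) = (χ j)⁻¹ * f (k * j) := fun _ _ => rfl
  have hFout : ∀ k x, F k x = (χ (x.out : J))⁻¹ * f (k * (x.out : J)) := fun k x => by
    conv_lhs => rw [← QuotientGroup.out_eq' x]
    exact hF k _
  refine ⟨fun k => ∑ x, F k x, ?_, ?_, ?_⟩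
  · have : (fun k => ∑ x, F k x) =
        ∑ x : J ⧸ N.subgroupOf J, (χ (x.out : J))⁻¹ • rightTranslate ((x.out : J) : G) f := by
      funext k
      simp only [Finset.sum_apply, Pi.smul_apply, smul_eq_mul, rightTranslate, hFout]
    rw [this]
    exact Submodule.sum_mem _ fun x _ => Submodule.smul_mem _ _ (hinv _ _ hfU)
  · have : ∀ x, F 1 x = f 1 := fun x => by
      rw [hFout, one_mul]
      have h2 := hU hfU _ (hJH (x.out : J).2) 1
      rw [mul_one] at h2
      rw [h2, inv_mul_cancel_left₀ (hne _ (hJH (x.out : J).2))]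
    simp only [this, Finset.sum_const, Finset.card_univ, nsmul_eq_mul]
    exact mul_ne_zero (Nat.cast_ne_zero.2 Fintype.card_ne_zero) hf1
  · intro j hj k
    rw [Finset.mul_sum]
    refine Fintype.sum_equiv (MulAction.toPerm (⟨j, hj⟩ : J)) _ _ fun x => ?_
    induction x using QuotientGroup.induction_on with
    | H y =>
      change F (k * j) (y : J ⧸ N.subgroupOf J) =
        χ j * F k ((⟨j, hj⟩ * y : J) : J ⧸ N.subgroupOf J)
      rw [hF, hF]
      have h2 := hne j (hJH hj)
      simp only [Subgroup.coe_mul, hmul j (hJH hj) y (hJH y.2), mul_inv, mul_assoc]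
      rw [mul_inv_cancel_left₀ h2]

/-- Irreducibility criterion for an induced character, tested on a subgroup `J ≤ H`. -/
theorem indChar_irreducible {ι : Type*} [Fintype ι] (s : ι → G) (hs : ∀ g, ∃! i, g * s i ∈ H)
    (hNJ : N ≤ J) (hJH : J ≤ H) [Finite (G ⧸ N)]
    (hmul : ∀ x ∈ H, ∀ y ∈ H, χ (x * y) = χ x * χ y) (hne : ∀ x ∈ H, χ x ≠ 0)
    (hχN : ∀ x ∈ N, χ x = 1)
    (hN : ∀ f ∈ indChar H χ, ∀ n ∈ N, ∀ k, f (k * n) = f k)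
    (h_intertwine : ∀ g, (∀ j ∈ J, g * j * g⁻¹ ∈ J → χ (g * j * g⁻¹) = χ j) → g ∈ H)
    {U : Submodule ℂ (G → ℂ)} (hU : U ≤ indChar H χ)
    (hinv : ∀ g, ∀ f ∈ U, rightTranslate g f ∈ U) (hU0 : U ≠ ⊥) : U = indChar H χ := by
  obtain ⟨f, hfU, hf1, hfJ⟩ := exists_equivariant_mem hNJ hJH hmul hne hχN
    (fun f hf => hN f (hU hf)) hU hinv hU0
  have hsupp : ∀ g, g ∉ H → f g = 0 := by
    intro g hg
    by_contra h0
    refine hg (h_intertwine g fun j hj hgj => ?_)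
    have h2 := hU hfU _ (hJH hgj) g
    rw [inv_mul_cancel_right, hfJ j hj g] at h2
    exact (mul_right_cancel₀ h0 h2).symm
  have hval : ∀ h ∈ H, f h = χ h * f 1 := fun h hh => by
    simpa using hU hfU h hh 1
  refine le_antisymm hU fun φ hφ => ?_
  have : φ = ∑ i, (φ (s i)⁻¹ / f 1) • rightTranslate (s i) f := by
    funext g
    obtain ⟨i, hi, hu⟩ := hs g
    simp only [Finset.sum_apply, Pi.smul_apply, smul_eq_mul, rightTranslate]
    rw [Finset.sum_eq_single i, hval _ hi]
    · have h2 := hφ _ hi (s i)⁻¹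
      rw [mul_inv_cancel_right] at h2
      rw [h2]
      field_simp
    · intro k _ hk
      rw [hsupp _ fun h => hk (hu k h), mul_zero]
    · simp
  rw [this]
  exact Submodule.sum_mem _ fun i _ => Submodule.smul_mem _ _ (hinv _ _ hfU)

end InducedCharacter

namespace USetting

section Valuation

variable (S : USetting E)

/-- `x` lies in the fractional ideal `p_E^n`. -/
def InP (n : ℤ) (x : E) : Prop := (n : WithTop ℤ) ≤ S.nu x

variable {S} {n m : ℤ} {x y : E}

theorem nu_zero : S.nu 0 = ⊤ := (S.nu_eq_top 0).2 rfl

theorem exists_nu_eq (hx : x ≠ 0) : ∃ k : ℤ, S.nu x = k := by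
  obtain ⟨k, hk⟩ := WithTop.ne_top_iff_exists.1 (mt (S.nu_eq_top x).1 hx)
  exact ⟨k, hk.symm⟩

theorem nu_one : S.nu 1 = 0 := by
  obtain ⟨k, hk⟩ := S.exists_nu_eq (one_ne_zero (α := E))
  have h := S.nu_mul 1 1
  rw [mul_one, hk] at h
  norm_cast at h
  rw [hk]
  norm_cast
  omega

theorem nu_neg_one : S.nu (-1) = 0 := by
  obtain ⟨k, hk⟩ := S.exists_nu_eq (neg_ne_zero.2 (one_ne_zero (α := E)))
  have h := S.nu_mul (-1) (-1)
  rw [neg_mul_neg, mul_one, nu_one, hk] at h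
  norm_cast at h
  rw [hk]
  norm_cast
  omega

theorem nu_neg (x : E) : S.nu (-x) = S.nu x := by
  rw [← neg_one_mul, S.nu_mul, nu_neg_one, zero_add]

theorem nu_inv {k : ℤ} (h : S.nu x = k) : S.nu x⁻¹ = (-k : ℤ) := by
  have hx : x ≠ 0 := fun h0 => by rw [h0, nu_zero] at h; exact WithTop.top_ne_coe h
  obtain ⟨l, hl⟩ := S.exists_nu_eq (inv_ne_zero hx)
  have h2 := S.nu_mul x x⁻¹
  rw [mul_inv_cancel₀ hx, nu_one, h, hl] at h2
  norm_cast at h2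
  rw [hl]
  norm_cast
  omega

theorem pi_ne_zero : S.pi ≠ 0 := fun h => by
  have := S.nu_pi
  rw [h, nu_zero] at this
  exact absurd this (by decide)

theorem nu_pi_zpow (k : ℤ) : S.nu (S.pi ^ k) = k := by
  have key : ∀ k : ℤ, S.nu (S.pi ^ k) = k → S.nu (S.pi ^ (k + 1)) = (k + 1 : ℤ) := by
    intro k hk
    rw [zpow_add_one₀ pi_ne_zero, S.nu_mul, hk, S.nu_pi]
    norm_cast
  induction k using Int.induction_on with
  | zero => simpa using S.nu_one
  | succ i ih => exact key _ ih
  | pred i ih =>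
    rw [zpow_sub_one₀ pi_ne_zero, S.nu_mul, ih, S.nu_inv (k := 1) (by simpa using S.nu_pi)]
    norm_cast

theorem sqeps_ne_zero : S.sqeps ≠ 0 := fun h => by
  have := S.nu_sqeps
  rw [h, nu_zero] at this
  exact absurd this (by decide)

theorem two_ne_zero' (S : USetting E) : (2 : E) ≠ 0 := fun h => by
  have := S.nu_two
  rw [h, nu_zero] at this
  exact absurd this (by decide)

theorem InP.zero (n : ℤ) : S.InP n 0 := by
  rw [InP, nu_zero]
  exact le_top

theorem InP.one : S.InP 0 1 := by
  rw [InP, nu_one]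
  exact le_rfl

theorem InP.of_nu_eq_zero (h : S.nu x = 0) : S.InP 0 x := by
  rw [InP, h]
  exact le_rfl

theorem InP.sqeps : S.InP 0 S.sqeps := .of_nu_eq_zero S.nu_sqeps

theorem InP.mono (hx : S.InP n x) (h : m ≤ n) : S.InP m x :=
  le_trans (by exact_mod_cast h) hx

theorem InP.neg (hx : S.InP n x) : S.InP n (-x) := by
  rw [InP, nu_neg]
  exact hx

theorem InP.add (hx : S.InP n x) (hy : S.InP n y) : S.InP n (x + y) :=
  le_trans (le_min hx hy) (S.nu_add x y)

theorem InP.sub (hx : S.InP n x) (hy : S.InP n y) : S.InP n (x - y) := by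
  rw [sub_eq_add_neg]
  exact hx.add hy.neg

theorem InP.sub_comm (h : S.InP n (x - y)) : S.InP n (y - x) := by
  rw [← neg_sub]
  exact h.neg

theorem InP.mul (hx : S.InP n x) (hy : S.InP m y) : S.InP (n + m) (x * y) := by
  rw [InP, S.nu_mul, WithTop.coe_add]
  exact add_le_add hx hy

theorem InP.mul_right (hx : S.InP n x) (hy : S.InP 0 y) : S.InP n (x * y) := by
  simpa using hx.mul hy

theorem InP.mul_left (hx : S.InP n x) (hy : S.InP 0 y) : S.InP n (y * x) := by
  simpa using hy.mul hx

theorem InP.sig (hx : S.InP n x) : S.InP n (S.sig x) := by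
  rw [InP, S.nu_sig]
  exact hx

theorem inP_unit_mul_iff (hy : S.nu y = 0) : S.InP n (y * x) ↔ S.InP n x := by
  rw [InP, S.nu_mul, hy, zero_add, InP]

theorem inP_mul_unit_iff (hy : S.nu y = 0) : S.InP n (x * y) ↔ S.InP n x := by
  rw [mul_comm, inP_unit_mul_iff hy]

theorem inP_mul_iff {k : ℤ} (hy : S.nu y = k) : S.InP n (y * x) ↔ S.InP (n - k) x := by
  rw [InP, S.nu_mul, hy, InP]
  by_cases hx : x = 0
  · simp [hx, nu_zero]
  · obtain ⟨l, hl⟩ := S.exists_nu_eq hx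
    rw [hl]
    norm_cast
    omega

theorem ne_zero_of_nu (hx : S.nu x = 0) : x ≠ 0 := fun h => by
  rw [h, nu_zero] at hx
  exact absurd hx (by decide)

theorem nu_inv_unit (hx : S.nu x = 0) : S.nu x⁻¹ = 0 := by
  simpa using S.nu_inv (k := 0) (by simpa using hx)

theorem nu_unit_mul (hx : S.nu x = 0) (hy : S.nu y = 0) : S.nu (x * y) = 0 := by
  rw [S.nu_mul, hx, hy, add_zero]

theorem not_inP_one_of_nu (hx : S.nu x = 0) : ¬ S.InP 1 x := by
  rw [InP, hx]
  decide

theorem nu_eq_zero_iff (hx : S.InP 0 x) : S.nu x = 0 ↔ ¬ S.InP 1 x := by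
  refine ⟨not_inP_one_of_nu, fun h => ?_⟩
  by_cases h0 : x = 0
  · exact absurd (h0 ▸ InP.zero 1) h
  · obtain ⟨l, hl⟩ := S.exists_nu_eq h0
    rw [InP, hl] at hx h
    rw [hl]
    norm_cast at hx h ⊢
    omega

theorem nu_eq_zero_of_sub (hx : S.nu x = 0) (h : S.InP 1 (x - y)) : S.nu y = 0 := by
  have hy : S.InP 0 y := by
    simpa using (InP.of_nu_eq_zero hx).sub (h.mono zero_le_one)
  rw [nu_eq_zero_iff hy]
  intro hy1
  exact not_inP_one_of_nu hx (by simpa using h.add hy1)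

/-- If a product of integral elements is a unit, so is the first factor. -/
theorem nu_left_of_mul (hx : S.InP 0 x) (hy : S.InP 0 y) (h : S.nu (x * y) = 0) :
    S.nu x = 0 := by
  rw [nu_eq_zero_iff hx]
  exact fun h1 => not_inP_one_of_nu h (h1.mul_right hy)

theorem eq_zero_of_forall_inP (h : ∀ k : ℕ, S.InP k x) : x = 0 := by
  by_contra h0
  obtain ⟨l, hl⟩ := S.exists_nu_eq h0
  have := h (l.toNat + 1)
  rw [InP, hl] at this
  norm_cast at this
  omega

theorem InP.half (hx : S.InP n x) : S.InP n (x / 2) := by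
  rw [div_eq_mul_inv, inP_mul_unit_iff (nu_inv_unit S.nu_two)]
  exact hx

theorem sig_inv (x : E) : S.sig x⁻¹ = (S.sig x)⁻¹ := map_inv₀ S.sig x

theorem sig_two : S.sig 2 = 2 := map_ofNat S.sig 2

/-- Square roots of elements of `1 + p_F^k`. -/
theorem exists_sqrt {k : ℕ} (hk : 1 ≤ k) (hy : S.sig y = y) (h : S.InP k (y - 1)) :
    ∃ r, S.sig r = r ∧ S.InP k (r - 1) ∧ r * r = y := by
  let f : ℕ → E := fun i => Nat.rec 1 (fun _ x => x - (x * x - y) / 2) i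
  have hf : ∀ i, f (i + 1) = f i - (f i * f i - y) / 2 := fun _ => rfl
  have h2 := S.two_ne_zero'
  have main : ∀ i : ℕ, S.sig (f i) = f i ∧ S.InP k (f i - 1) ∧
      S.InP (k + i) (f i * f i - y) := by
    intro i
    induction i with
    | zero =>
      refine ⟨map_one _, by simpa [f] using InP.zero _, ?_⟩
      simpa [f] using h.sub_comm
    | succ i ih =>
      obtain ⟨h3, h4, h5⟩ := ih
      rw [hf]
      refine ⟨by simp [h3, hy, sig_two], ?_, ?_⟩
      · have := h4.sub (h5.half.mono (by omega : (k : ℤ) ≤ k + i))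
        convert this using 1
        ring
      · have e : (f i - (f i * f i - y) / 2) * (f i - (f i * f i - y) / 2) - y =
            (f i * f i - y) / 2 * ((f i * f i - y) / 2) - (f i - 1) * (f i * f i - y) := by
          field_simp
          ring
        rw [e]
        push_cast
        exact ((h5.half.mul h5.half).mono (by omega)).sub ((h4.mul h5).mono (by omega))
  obtain ⟨L, hL⟩ := S.complete f fun i => by
    have := (main i).2.2.half.neg.mono (by omega : (i : ℤ) ≤ k + i)
    rw [hf, sub_sub_cancel_left]
    exact this
  have hL' : ∀ i : ℕ, S.InP i (L - f i) := hL
  have hLk : S.InP k (L - 1) := by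
    convert (hL' k).add (main k).2.1 using 1
    ring
  have hL0 : S.InP 0 L := by
    simpa using (hLk.mono (by omega : (0 : ℤ) ≤ k)).add InP.one
  refine ⟨L, ?_, hLk, ?_⟩
  · rw [← sub_eq_zero]
    refine S.eq_zero_of_forall_inP fun i => ?_
    have := (hL' i).sig.sub (hL' i)
    rw [map_sub, (main i).1] at this
    simpa using this
  · rw [← sub_eq_zero]
    refine S.eq_zero_of_forall_inP fun i => ?_
    have hfi : S.InP 0 (f i) := by
      simpa using ((main i).2.1.mono (by omega : (0 : ℤ) ≤ k)).add InP.one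
    have := ((hL' i).mul_right (hL0.add hfi)).add ((main i).2.2.mono (by omega : (i : ℤ) ≤ k + i))
    convert this using 1
    ring

/-! ### The additive character -/

theorem sig_half_trace (x : E) : S.sig ((x + S.sig x) / 2) = (x + S.sig x) / 2 := by
  simp [S.sig_invol, add_comm, sig_two]

theorem psiE_add (x y : E) : psiE S (x + y) = psiE S x * psiE S y := by
  rw [psiE, psiE, psiE, ← S.psi'_mul _ _ (sig_half_trace x) (sig_half_trace y)]
  congr 1
  rw [map_add]
  ring

theorem psiE_ne_zero (x : E) : psiE S x ≠ 0 := S.psi'_ne _ (sig_half_trace x)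

theorem psiE_of_fixed (h : S.sig x = x) : psiE S x = S.psi' x := by
  have h2 := S.two_ne_zero'
  rw [psiE, h]
  congr 1
  field_simp
  ring

theorem psiE_eq_one (h : S.InP 1 x) : psiE S x = 1 :=
  S.psi'_triv _ (sig_half_trace x) (h.add h.sig).half

theorem psiE_sub_eq_one (h : psiE S x = psiE S y) : psiE S (x - y) = 1 := by
  have h2 := S.psiE_add (x - y) y
  rw [sub_add_cancel, h] at h2
  exact (mul_eq_right₀ (psiE_ne_zero y)).1 h2.symm

/-- The ideal `p_F^{1-k}` is the annihilator of `p_F^k` under the pairing `ψ′(xt)`. -/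
theorem inP_of_psi'_eq_one {k : ℤ} (hx : S.sig x = x)
    (h : ∀ t, S.sig t = t → S.InP k t → S.psi' (x * t) = 1) : S.InP (1 - k) x := by
  by_contra hn
  obtain ⟨x₀, hs, h0, h1⟩ := S.psi'_nontriv
  have hx0 : x ≠ 0 := fun h => hn (h ▸ InP.zero _)
  obtain ⟨l, hl⟩ := S.exists_nu_eq hx0
  refine h1 ?_
  have := h (x⁻¹ * x₀) (by rw [map_mul, sig_inv, hx, hs]) ?_
  · rwa [mul_inv_cancel_left₀ hx0] at this
  · rw [inP_mul_iff (S.nu_inv hl)]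
    refine InP.mono (n := 0) h0 ?_
    rw [InP, hl] at hn
    norm_cast at hn
    omega

end Valuation

end USetting

namespace USetting

section Residue

variable (S : USetting E)

/-- The ring of integers `O_F` of the fixed field. -/
def intF : Subring E where
  carrier := {x | S.sig x = x ∧ S.InP 0 x}
  mul_mem' := fun ha hb => ⟨by rw [map_mul, ha.1, hb.1], ha.2.mul_right hb.2⟩
  one_mem' := ⟨map_one _, InP.one⟩
  add_mem' := fun ha hb => ⟨by rw [map_add, ha.1, hb.1], ha.2.add hb.2⟩
  zero_mem' := ⟨map_zero _, InP.zero 0⟩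
  neg_mem' := fun ha => ⟨by rw [map_neg, ha.1], ha.2.neg⟩

/-- The maximal ideal `p_F` of `O_F`. -/
def maxF : Ideal S.intF where
  carrier := {x | S.InP 1 (x : E)}
  add_mem' := fun ha hb => ha.add hb
  zero_mem' := InP.zero 1
  smul_mem' := fun c _ hx => InP.mul_left hx c.2.2

variable {S} {x y : E}

theorem mem_maxF {x : S.intF} : x ∈ S.maxF ↔ S.InP 1 (x : E) := Iff.rfl

instance maxF_isMaximal : S.maxF.IsMaximal := by
  rw [Ideal.isMaximal_iff]
  refine ⟨not_inP_one_of_nu nu_one, fun I x hI hx hxI => ?_⟩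
  have hu : S.nu (x : E) = 0 := (nu_eq_zero_iff x.2.2).2 hx
  have h2 : (x : E)⁻¹ ∈ S.intF :=
    ⟨by rw [sig_inv, x.2.1], .of_nu_eq_zero (nu_inv_unit hu)⟩
  have : (⟨_, h2⟩ : S.intF) * x = 1 := Subtype.ext (inv_mul_cancel₀ (ne_zero_of_nu hu))
  rw [← this]
  exact I.mul_mem_left _ hxI

instance finite_residue : Finite (S.intF ⧸ S.maxF) := by
  obtain ⟨R, -, hR, hR2⟩ := S.res_card
  let f : R → S.intF ⧸ S.maxF := fun x => Ideal.Quotient.mk _ ⟨x.1, hR x.1 x.2⟩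
  refine Finite.of_surjective f fun y => ?_
  obtain ⟨y, rfl⟩ := Ideal.Quotient.mk_surjective y
  obtain ⟨x, ⟨hx, hxy⟩, -⟩ := hR2 y y.2.1 y.2.2
  refine ⟨⟨x, hx⟩, ?_⟩
  rw [Ideal.Quotient.eq, mem_maxF]
  exact InP.sub_comm hxy

open Polynomial in
/-- The norm form `a² - εb²` represents every residue class. -/
theorem exists_norm_form_residue (hy : S.sig y = y) (hy0 : S.InP 0 y) :
    ∃ a b, S.sig a = a ∧ S.InP 0 a ∧ S.sig b = b ∧ S.InP 0 b ∧
      S.InP 1 (a * a - b * b * (S.sqeps * S.sqeps) - y) := by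
  let _ : Field (S.intF ⧸ S.maxF) := Ideal.Quotient.field _
  have := Fintype.ofFinite (S.intF ⧸ S.maxF)
  let π := Ideal.Quotient.mk S.maxF
  have hε : S.sqeps * S.sqeps ∈ S.intF :=
    ⟨by rw [map_mul, S.sig_sqeps, neg_mul_neg], InP.sqeps.mul_right InP.sqeps⟩
  have hchar : ringChar (S.intF ⧸ S.maxF) ≠ 2 := by
    intro h
    have h2 : ((2 : ℕ) : S.intF ⧸ S.maxF) = 0 := by
      rw [← h]
      exact ringChar.Nat.cast_ringChar
    have h3 : π (2 : S.intF) = 0 := (map_ofNat π 2).trans (by exact_mod_cast h2)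
    rw [Ideal.Quotient.eq_zero_iff_mem, mem_maxF] at h3
    exact not_inP_one_of_nu S.nu_two h3
  have hπε : π ⟨_, hε⟩ ≠ 0 := by
    rw [Ne, Ideal.Quotient.eq_zero_iff_mem, mem_maxF]
    exact not_inP_one_of_nu (nu_unit_mul S.nu_sqeps S.nu_sqeps)
  obtain ⟨a, b, hab⟩ := FiniteField.exists_root_sum_quadratic
    (f := X ^ 2 - C (π ⟨y, hy, hy0⟩)) (g := C (-π ⟨_, hε⟩) * X ^ 2)
    (degree_X_pow_sub_C two_pos _) (degree_C_mul_X_pow 2 (neg_ne_zero.2 hπε))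
    (FiniteField.odd_card_of_char_ne_two hchar)
  obtain ⟨a, rfl⟩ := Ideal.Quotient.mk_surjective a
  obtain ⟨b, rfl⟩ := Ideal.Quotient.mk_surjective b
  refine ⟨a, b, a.2.1, a.2.2, b.2.1, b.2.2, ?_⟩
  have h : π (a * a - b * b * ⟨_, hε⟩ - ⟨y, hy, hy0⟩) = 0 := by
    rw [← hab]
    simp only [eval_sub, eval_pow, eval_X, eval_C, eval_mul, map_sub, map_mul]
    ring
  rw [Ideal.Quotient.eq_zero_iff_mem] at h
  exact h

/-- Every unit of `O_F` is a norm from `E`. -/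
theorem exists_norm_eq (hy : S.sig y = y) (hy0 : S.nu y = 0) :
    ∃ α, S.nu α = 0 ∧ α * S.sig α = y := by
  obtain ⟨a, b, ha, ha0, hb, hb0, h⟩ := exists_norm_form_residue hy (.of_nu_eq_zero hy0)
  set β := a + b * S.sqeps with hβ
  have hβ0 : S.InP 0 β := ha0.add (hb0.mul_right InP.sqeps)
  have hσβ : S.sig β = a - b * S.sqeps := by
    rw [hβ, map_add, map_mul, ha, hb, S.sig_sqeps]
    ring
  have hN : β * S.sig β = a * a - b * b * (S.sqeps * S.sqeps) := by
    rw [hσβ, hβ]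
    ring
  rw [← hN] at h
  have hNu : S.nu (β * S.sig β) = 0 := nu_eq_zero_of_sub hy0 h.sub_comm
  have hβu : S.nu β = 0 := nu_left_of_mul hβ0 hβ0.sig hNu
  have hN0 := ne_zero_of_nu hNu
  obtain ⟨r, hr, hr1, hrr⟩ := exists_sqrt (S := S) (k := 1) (y := y * (β * S.sig β)⁻¹) le_rfl
    (by rw [map_mul, sig_inv, map_mul, S.sig_invol, hy, mul_comm (S.sig β)]) (by
      rw [← inP_mul_unit_iff hNu, sub_mul, inv_mul_cancel_right₀ hN0, one_mul]
      exact h.sub_comm)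
  refine ⟨β * r, nu_unit_mul hβu (nu_eq_zero_of_sub nu_one hr1.sub_comm), ?_⟩
  rw [map_mul, hr, show β * r * (S.sig β * r) = (r * r) * (β * S.sig β) by ring, hrr,
    inv_mul_cancel_right₀ hN0]

/-- `T` is a set of representatives for `A` modulo `p_E^l`. -/
def IsTransversal (S : USetting E) (A : Set E) (l : ℤ) (T : Finset E) : Prop :=
  (∀ x ∈ T, x ∈ A) ∧ ∀ y ∈ A, ∃! x, x ∈ T ∧ S.InP l (y - x)

/-- The ideal `p_F^k` of `O_F`. -/
def idealF (S : USetting E) (k : ℤ) : Set E := {x | S.sig x = x ∧ S.InP k x}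

theorem sig_pi_zpow (k : ℤ) : S.sig (S.pi ^ k) = S.pi ^ k := by
  rw [map_zpow₀, S.sig_pi]

/-- Representatives modulo `p^l` and of `p^l` modulo `p^l'` combine by addition. -/
theorem IsTransversal.add {A : Set E} {l l' : ℤ} {T T' : Finset E} (hl : l ≤ l')
    (hT : S.IsTransversal A l T) (hT' : S.IsTransversal (S.idealF l) l' T')
    (hfix : ∀ x ∈ A, S.sig x = x) (hA : ∀ x ∈ A, ∀ t ∈ S.idealF l, x + t ∈ A) :
    ∃ T'' : Finset E, T''.card = T.card * T'.card ∧ S.IsTransversal A l' T'' := by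
  classical
  have huniq : ∀ x₁ ∈ T, ∀ t₁ ∈ T', ∀ x₂ ∈ T, ∀ t₂ ∈ T',
      S.InP l' (x₁ + t₁ - (x₂ + t₂)) → x₁ = x₂ ∧ t₁ = t₂ := by
    intro x₁ hx₁ t₁ ht₁ x₂ hx₂ t₂ ht₂ h
    have e : x₁ = x₂ := by
      refine (hT.2 x₁ (hT.1 x₁ hx₁)).unique ⟨hx₁, by simpa using InP.zero l⟩ ⟨hx₂, ?_⟩
      convert ((h.mono hl).sub (hT'.1 t₁ ht₁).2).add (hT'.1 t₂ ht₂).2 using 1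
      ring
    subst e
    refine ⟨rfl, (hT'.2 t₁ (hT'.1 t₁ ht₁)).unique ⟨ht₁, by simpa using InP.zero l'⟩ ⟨ht₂, ?_⟩⟩
    simpa using h
  refine ⟨Finset.image₂ (· + ·) T T', Finset.card_image₂_iff.2 ?_, ?_, ?_⟩
  · rintro ⟨x₁, t₁⟩ h₁ ⟨x₂, t₂⟩ h₂ h
    obtain ⟨e, e'⟩ := huniq x₁ h₁.1 t₁ h₁.2 x₂ h₂.1 t₂ h₂.2 (by
      have : x₁ + t₁ = x₂ + t₂ := h
      rw [this, sub_self]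
      exact InP.zero _)
    rw [e, e']
  · intro x hx
    obtain ⟨a, ha, t, ht, rfl⟩ := Finset.mem_image₂.1 hx
    exact hA a (hT.1 a ha) t (hT'.1 t ht)
  · intro y hy
    obtain ⟨x, ⟨hx, hxy⟩, -⟩ := hT.2 y hy
    obtain ⟨t, ⟨ht, hty⟩, -⟩ := hT'.2 (y - x)
      ⟨by rw [map_sub, hfix y hy, hfix x (hT.1 x hx)], hxy⟩
    rw [sub_sub] at hty
    refine ⟨x + t, ⟨Finset.mem_image₂_of_mem hx ht, hty⟩, ?_⟩
    rintro z ⟨hz, hyz⟩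
    obtain ⟨x₂, hx₂, t₂, ht₂, rfl⟩ := Finset.mem_image₂.1 hz
    obtain ⟨rfl, rfl⟩ := huniq x₂ hx₂ t₂ ht₂ x hx t ht (by
      convert hty.sub hyz using 1
      ring)
    rfl

theorem exists_transversal_succ (k : ℤ) :
    ∃ T : Finset E, T.card = S.q ∧ S.IsTransversal (S.idealF k) (k + 1) T := by
  classical
  obtain ⟨R, hcard, hR, hR2⟩ := S.res_card
  have hp : S.pi ^ k ≠ 0 := zpow_ne_zero _ pi_ne_zero
  refine ⟨R.image (S.pi ^ k * ·), ?_, ?_, ?_⟩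
  · rw [Finset.card_image_of_injective _ (mul_right_injective₀ hp), hcard]
  · intro x hx
    obtain ⟨r, hr, rfl⟩ := Finset.mem_image.1 hx
    refine ⟨by rw [map_mul, sig_pi_zpow, (hR r hr).1], ?_⟩
    rw [inP_mul_iff (nu_pi_zpow k), sub_self]
    exact (hR r hr).2
  · intro y hy
    have hy' : S.pi ^ k * ((S.pi ^ k)⁻¹ * y) = y := mul_inv_cancel_left₀ hp y
    have hz0 : S.InP 0 ((S.pi ^ k)⁻¹ * y) := by
      have := hy.2
      rwa [← hy', inP_mul_iff (nu_pi_zpow k), sub_self] at this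
    have hiff : ∀ r, S.InP (k + 1) (y - S.pi ^ k * r) ↔ S.InP 1 ((S.pi ^ k)⁻¹ * y - r) := by
      intro r
      rw [show y - S.pi ^ k * r = S.pi ^ k * ((S.pi ^ k)⁻¹ * y - r) by rw [mul_sub, hy'],
        inP_mul_iff (nu_pi_zpow k), add_sub_cancel_left]
    obtain ⟨r, ⟨hr, hry⟩, hru⟩ := hR2 ((S.pi ^ k)⁻¹ * y)
      (by rw [map_mul, sig_inv, sig_pi_zpow, hy.1]) hz0
    refine ⟨S.pi ^ k * r, ⟨Finset.mem_image_of_mem _ hr, (hiff r).2 hry⟩, ?_⟩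
    rintro x ⟨hx, hxy⟩
    obtain ⟨r', hr', rfl⟩ := Finset.mem_image.1 hx
    rw [hru r' ⟨hr', (hiff r').1 hxy⟩]

theorem idealF_add {k l : ℤ} (h : k ≤ l) : ∀ x ∈ S.idealF k, ∀ t ∈ S.idealF l,
    x + t ∈ S.idealF k := fun _ hx _ ht =>
  ⟨by rw [map_add, hx.1, ht.1], hx.2.add (ht.2.mono h)⟩

/-- Representatives of `p_F^k / p_F^{k+j}`; there are `q^j` of them. -/
theorem exists_transversal (k : ℤ) (j : ℕ) :
    ∃ T : Finset E, T.card = S.q ^ j ∧ S.IsTransversal (S.idealF k) (k + j) T := by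
  induction j with
  | zero =>
    refine ⟨{0}, by simp, by simpa [idealF] using InP.zero k, fun y hy => ⟨0, ?_, ?_⟩⟩
    · simpa using hy.2
    · rintro x ⟨hx, -⟩
      simpa using hx
  | succ j ih =>
    obtain ⟨T, hc, hT⟩ := ih
    obtain ⟨T', hc', hT'⟩ := S.exists_transversal_succ (k + j)
    obtain ⟨T'', hc'', hT''⟩ := hT.add (by omega) hT' (fun x hx => hx.1)
      (idealF_add (by omega))
    refine ⟨T'', by rw [hc'', hc, hc', pow_succ], ?_⟩
    push_cast
    rwa [← add_assoc]

/-- Representatives of `O_F^× / (1 + p_F^{j+1})`; there are `(q-1)q^j` of them. -/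
theorem exists_unit_transversal (j : ℕ) :
    ∃ T : Finset E, T.card = (S.q - 1) * S.q ^ j ∧ S.IsTransversal (OFunits S) (j + 1) T := by
  classical
  obtain ⟨R, hc, hR⟩ := S.exists_transversal_succ 0
  obtain ⟨r₀, ⟨hr₀, hr₀'⟩, hu⟩ := hR.2 0 ⟨map_zero _, InP.zero 0⟩
  rw [zero_add] at hR hr₀' hu
  have hmem : ∀ x ∈ R, x ≠ r₀ ↔ S.nu x = 0 := by
    intro x hx
    rw [nu_eq_zero_iff (hR.1 x hx).2, not_iff_not]
    refine ⟨fun h => ?_, fun h => hu x ⟨hx, by simpa using h.neg⟩⟩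
    rw [h]
    simpa using hr₀'.neg
  have hT : S.IsTransversal (OFunits S) 1 (R.erase r₀) := by
    refine ⟨fun x hx => ?_, fun y hy => ?_⟩
    · rw [Finset.mem_erase] at hx
      exact ⟨(hR.1 x hx.2).1, (hmem x hx.2).1 hx.1⟩
    · obtain ⟨x, ⟨hx, hxy⟩, hxu⟩ := hR.2 y ⟨hy.1, .of_nu_eq_zero hy.2⟩
      refine ⟨x, ⟨Finset.mem_erase.2 ⟨(hmem x hx).2 (nu_eq_zero_of_sub hy.2 hxy), hx⟩, hxy⟩, ?_⟩
      rintro z ⟨hz, hzy⟩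
      exact hxu z ⟨Finset.mem_of_mem_erase hz, hzy⟩
  obtain ⟨T', hc', hT'⟩ := S.exists_transversal 1 j
  obtain ⟨T'', hc'', hT''⟩ := hT.add (by omega) hT' (fun x hx => hx.1)
    (fun x hx t ht => ⟨by rw [map_add, hx.1, ht.1],
      nu_eq_zero_of_sub hx.2 (by simpa using ht.2.neg)⟩)
  refine ⟨T'', by rw [hc'', hc', Finset.card_erase_of_mem hr₀, hc], ?_⟩
  rwa [add_comm]

theorem one_le_q : 1 ≤ S.q := by
  obtain ⟨R, hc, -, hR⟩ := S.res_card
  obtain ⟨r, ⟨hr, -⟩, -⟩ := hR 0 (map_zero _) (InP.zero 0)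
  rw [← hc]
  exact Finset.card_pos.2 ⟨r, hr⟩

end Residue

end USetting

namespace USetting

section Groups

variable (S : USetting E)

/-- The inverse `w₀ σ(g)ᵀ w₀` of an element `g` of the unitary group. -/
def starInv (g : Mat E) : Mat E :=
  !![S.sig (g 1 1), S.sig (g 0 1); S.sig (g 1 0), S.sig (g 0 0)]

/-- All entries of `A` lie in `p_E^n`. -/
def MatInP (n : ℤ) (A : Mat E) : Prop := ∀ i j, S.InP n (A i j)

/-- The lattice of matrices with lower left entry in `p_E^n` and the others in `p_E^m`. -/
def Lat (m n : ℤ) (A : Mat E) : Prop :=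
  S.InP m (A 0 0) ∧ S.InP m (A 0 1) ∧ S.InP m (A 1 1) ∧ S.InP n (A 1 0)

variable {S} {g h A B : Mat E} {m n : ℤ}

theorem mul_apply_two (A B : Mat E) (i j : Fin 2) :
    (A * B) i j = A i 0 * B 0 j + A i 1 * B 1 j := by
  rw [Matrix.mul_apply, Fin.sum_univ_two]

theorem mem_Gset_iff : g ∈ Gset S ↔ S.starInv g * g = 1 := by
  have e : S.starInv g = w0 E * ((g.map S.sig)ᵀ * w0 E) := by
    ext i j
    fin_cases i <;> fin_cases j <;> simp [starInv, w0, mul_apply_two]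
  have hw : w0 E * w0 E = 1 := by
    ext i j
    fin_cases i <;> fin_cases j <;> simp [w0, mul_apply_two]
  rw [e, Matrix.mul_assoc]
  constructor
  · intro h
    rw [Gset, Set.mem_ofPred_eq] at h
    rw [h, hw]
  · intro h
    have h2 := congrArg (w0 E * ·) h
    simp only [← Matrix.mul_assoc, hw, one_mul, mul_one] at h2
    exact h2

theorem mul_starInv (hg : S.starInv g * g = 1) : g * S.starInv g = 1 :=
  mul_eq_one_comm.1 hg

theorem starInv_starInv (g : Mat E) : S.starInv (S.starInv g) = g := by
  ext i j
  fin_cases i <;> fin_cases j <;> simp [starInv, S.sig_invol]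

theorem starInv_mul (g h : Mat E) : S.starInv (g * h) = S.starInv h * S.starInv g := by
  ext i j
  fin_cases i <;> fin_cases j <;> simp [starInv, mul_apply_two] <;> ring

theorem det_starInv (g : Mat E) : (S.starInv g).det = S.sig g.det := by
  simp [starInv, Matrix.det_fin_two]
  ring

theorem mem_Kset_iff : g ∈ Kset S ↔ S.starInv g * g = 1 ∧ S.MatInP 0 g := by
  rw [Kset, Set.mem_ofPred_eq, mem_Gset_iff]
  refine ⟨fun h => ⟨h.1, h.2.1⟩, fun h => ⟨h.1, h.2, ?_⟩⟩
  have hd : S.InP 0 g.det := by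
    rw [Matrix.det_fin_two]
    exact ((h.2 0 0).mul_right (h.2 1 1)).sub ((h.2 0 1).mul_right (h.2 1 0))
  refine nu_left_of_mul hd hd.sig ?_
  rw [mul_comm, ← det_starInv, ← Matrix.det_mul, h.1, Matrix.det_one, nu_one]

theorem MatInP.mul (hA : S.MatInP n A) (hB : S.MatInP m B) : S.MatInP (n + m) (A * B) := by
  intro i j
  rw [mul_apply_two]
  exact ((hA i 0).mul (hB 0 j)).add ((hA i 1).mul (hB 1 j))

theorem MatInP.starInv (hA : S.MatInP n A) : S.MatInP n (S.starInv A) := by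
  intro i j
  fin_cases i <;> fin_cases j
  exacts [(hA 1 1).sig, (hA 0 1).sig, (hA 1 0).sig, (hA 0 0).sig]

theorem MatInP.add (hA : S.MatInP n A) (hB : S.MatInP n B) : S.MatInP n (A + B) :=
  fun i j => (hA i j).add (hB i j)

theorem starInv_sub_one (A : Mat E) : S.starInv A - 1 = S.starInv (A - 1) := by
  ext i j
  fin_cases i <;> fin_cases j <;> simp [USetting.starInv]

theorem kset_one : (1 : Mat E) ∈ Kset S := by
  refine mem_Kset_iff.2 ⟨?_, ?_⟩
  · ext i j
    fin_cases i <;> fin_cases j <;> simp [starInv]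
  · intro i j
    fin_cases i <;> fin_cases j
    exacts [InP.one, InP.zero 0, InP.zero 0, InP.one]

theorem kset_mul (hg : g ∈ Kset S) (hh : h ∈ Kset S) : g * h ∈ Kset S := by
  rw [mem_Kset_iff] at *
  refine ⟨?_, by simpa using hg.2.mul hh.2⟩
  rw [starInv_mul, Matrix.mul_assoc, ← Matrix.mul_assoc _ g, hg.1, one_mul, hh.1]

theorem kset_starInv (hg : g ∈ Kset S) : S.starInv g ∈ Kset S := by
  rw [mem_Kset_iff] at *
  exact ⟨by rw [starInv_starInv, mul_starInv hg.1], hg.2.starInv⟩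

theorem kset_inP (hg : g ∈ Kset S) (i j : Fin 2) : S.InP 0 (g i j) := (mem_Kset_iff.1 hg).2 i j

theorem kset_starInv_mul_self (hg : g ∈ Kset S) : S.starInv g * g = 1 := (mem_Kset_iff.1 hg).1

theorem kset_mul_starInv_self (hg : g ∈ Kset S) : g * S.starInv g = 1 :=
  mul_starInv (kset_starInv_mul_self hg)

/-- The entrywise relations defining the unitary group. -/
theorem kset_relations (hg : g ∈ Kset S) :
    S.sig (g 1 1) * g 0 0 + S.sig (g 0 1) * g 1 0 = 1 ∧
    S.sig (g 1 1) * g 0 1 + S.sig (g 0 1) * g 1 1 = 0 ∧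
    S.sig (g 1 0) * g 0 0 + S.sig (g 0 0) * g 1 0 = 0 ∧
    S.sig (g 1 0) * g 0 1 + S.sig (g 0 0) * g 1 1 = 1 := by
  have h := (kset_starInv_mul_self hg)
  have e := fun i j => congrFun (congrFun h i) j
  refine ⟨?_, ?_, ?_, ?_⟩
  · simpa [mul_apply_two, USetting.starInv] using e 0 0
  · simpa [mul_apply_two, USetting.starInv] using e 0 1
  · simpa [mul_apply_two, USetting.starInv] using e 1 0
  · simpa [mul_apply_two, USetting.starInv] using e 1 1

/-- The same relations for the inverse. -/
theorem kset_relations' (hg : g ∈ Kset S) :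
    g 0 0 * S.sig (g 1 1) + g 0 1 * S.sig (g 1 0) = 1 ∧
    g 0 0 * S.sig (g 0 1) + g 0 1 * S.sig (g 0 0) = 0 ∧
    g 1 0 * S.sig (g 1 1) + g 1 1 * S.sig (g 1 0) = 0 := by
  have h := (kset_mul_starInv_self hg)
  have e := fun i j => congrFun (congrFun h i) j
  refine ⟨?_, ?_, ?_⟩
  · simpa [mul_apply_two, USetting.starInv] using e 0 0
  · simpa [mul_apply_two, USetting.starInv] using e 0 1
  · simpa [mul_apply_two, USetting.starInv] using e 1 0

theorem MatInP.conj_sub_one (hg : g ∈ Kset S) (hh : S.MatInP n (h - 1)) :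
    S.MatInP n (g * h * S.starInv g - 1) := by
  have e : g * h * S.starInv g - 1 = g * (h - 1) * S.starInv g := by
    rw [mul_sub, sub_mul, mul_one, (kset_mul_starInv_self hg)]
  rw [e]
  have hg' := mem_Kset_iff.1 hg
  simpa using (hg'.2.mul hh).mul hg'.2.starInv

theorem Lat.mul_left (hA : S.Lat m n A) (hmn : m ≤ n) (hnm : n ≤ m + 1) (hB : S.MatInP 0 B)
    (hB1 : S.InP 1 (B 1 0)) : S.Lat m n (B * A) := by
  obtain ⟨h1, h2, h3, h4⟩ := hA
  simp only [Lat, mul_apply_two]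
  exact ⟨(h1.mul_left (hB 0 0)).add ((h4.mono hmn).mul_left (hB 0 1)),
    (h2.mul_left (hB 0 0)).add (h3.mul_left (hB 0 1)),
    (h2.mul_left (hB 1 0)).add (h3.mul_left (hB 1 1)),
    ((hB1.mul h1).mono (by omega)).add (h4.mul_left (hB 1 1))⟩

theorem Lat.mul_right (hA : S.Lat m n A) (hmn : m ≤ n) (hnm : n ≤ m + 1) (hB : S.MatInP 0 B)
    (hB1 : S.InP 1 (B 1 0)) : S.Lat m n (A * B) := by
  obtain ⟨h1, h2, h3, h4⟩ := hA
  simp only [Lat, mul_apply_two]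
  exact ⟨(h1.mul_right (hB 0 0)).add (h2.mul_right (hB 1 0)),
    (h1.mul_right (hB 0 1)).add (h2.mul_right (hB 1 1)),
    ((h4.mono hmn).mul_right (hB 0 1)).add (h3.mul_right (hB 1 1)),
    (h4.mul_right (hB 0 0)).add ((h3.mul hB1).mono (by omega))⟩

theorem Lat.add (hA : S.Lat m n A) (hB : S.Lat m n B) : S.Lat m n (A + B) :=
  ⟨hA.1.add hB.1, hA.2.1.add hB.2.1, hA.2.2.1.add hB.2.2.1, hA.2.2.2.add hB.2.2.2⟩

theorem Lat.starInv (hA : S.Lat m n A) : S.Lat m n (S.starInv A) :=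
  ⟨hA.2.2.1.sig, hA.2.1.sig, hA.1.sig, hA.2.2.2.sig⟩

theorem Lat.inP_one (hA : S.Lat m n (A - 1)) (hn : 1 ≤ n) : S.InP 1 (A 1 0) := by
  simpa using hA.2.2.2.mono hn

theorem Lat.conj_sub_one (hmn : m ≤ n) (hnm : n ≤ m + 1) (hg : g ∈ Kset S)
    (hg1 : S.InP 1 (g 1 0)) (hh : S.Lat m n (h - 1)) :
    S.Lat m n (g * h * S.starInv g - 1) := by
  have e : g * h * S.starInv g - 1 = g * (h - 1) * S.starInv g := by
    rw [mul_sub, sub_mul, mul_one, (kset_mul_starInv_self hg)]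
  rw [e]
  have hg' := mem_Kset_iff.1 hg
  exact (hh.mul_left hmn hnm hg'.2 hg1).mul_right hmn hnm hg'.2.starInv hg1.sig

theorem MatInP.lat {k : ℤ} (hA : S.MatInP k A) (hm : m ≤ k) (hn : n ≤ k) : S.Lat m n A :=
  ⟨(hA 0 0).mono hm, (hA 0 1).mono hm, (hA 1 1).mono hm, (hA 1 0).mono hn⟩

theorem mem_Jgrp_iff {d : ℕ} : g ∈ Jgrp S d ↔
    g ∈ Kset S ∧ S.Lat ((d + 1) / 2 : ℕ) (d / 2 + 1 : ℕ) (g - 1) := by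
  have e : ∀ (k : ℕ) (x : E), (k : WithTop ℤ) ≤ S.nu x ↔ S.InP k x := fun _ _ => Iff.rfl
  simp only [Jgrp, Set.mem_ofPred_eq, e, Lat, Matrix.sub_apply, Matrix.one_apply_eq,
    Matrix.one_apply_ne zero_ne_one, Matrix.one_apply_ne one_ne_zero, sub_zero]

variable (S)

/-- `K` as a subgroup of the unit group of the matrix ring. -/
def Kgrp : Subgroup (Mat E)ˣ where
  carrier := {g | (g : Mat E) ∈ Kset S}
  mul_mem' := fun ha hb => by simpa using kset_mul ha hb
  one_mem' := by simpa using kset_one (S := S)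
  inv_mem' := fun {g} hg => by
    have hg' : (g : Mat E) ∈ Kset S := hg
    have e : ((g⁻¹ : (Mat E)ˣ) : Mat E) = S.starInv g :=
      Units.inv_eq_of_mul_eq_one_left (kset_starInv_mul_self hg')
    rw [Set.mem_ofPred_eq, e]
    exact kset_starInv hg'

variable {S}

/-- The underlying matrix of an element of `K`. -/
def mat (g : S.Kgrp) : Mat E := ((g : (Mat E)ˣ) : Mat E)

theorem mat_mem (g : S.Kgrp) : mat g ∈ Kset S := g.2

theorem mat_mul (g h : S.Kgrp) : mat (g * h) = mat g * mat h := rfl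

theorem mat_one : mat (1 : S.Kgrp) = 1 := rfl

theorem mat_inv (g : S.Kgrp) : mat g⁻¹ = S.starInv (mat g) := by
  refine Eq.symm (left_inv_eq_right_inv (a := mat g) ?_ ?_)
  · exact (kset_starInv_mul_self (mat_mem g))
  · rw [← mat_mul, mul_inv_cancel, mat_one]

theorem mat_injective : Function.Injective (mat : S.Kgrp → Mat E) := fun _ _ h =>
  Subtype.ext (Units.ext h)

/-- An element of `K` from its matrix. -/
def ofMat (g : Mat E) (hg : g ∈ Kset S) : S.Kgrp :=
  ⟨⟨g, S.starInv g, (kset_mul_starInv_self hg), (kset_starInv_mul_self hg)⟩, hg⟩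

theorem mat_ofMat (hg : g ∈ Kset S) : mat (ofMat g hg) = g := rfl

variable (S)

/-- The group `1 + Lat m n` inside `K`. -/
def Jsub {m n : ℕ} (hm : 1 ≤ m) (hmn : m ≤ n) (hnm : n ≤ m + 1) : Subgroup S.Kgrp where
  carrier := {g | S.Lat m n (mat g - 1)}
  mul_mem' := by
    intro a b (ha : S.Lat m n (mat a - 1)) (hb : S.Lat m n (mat b - 1))
    have e : mat (a * b) - 1 = (mat a - 1) * mat b + (mat b - 1) := by
      rw [mat_mul, sub_mul, one_mul, sub_add_sub_cancel]
    rw [Set.mem_ofPred_eq, e]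
    exact (ha.mul_right (by omega) (by omega) (kset_inP (mat_mem b))
      (hb.inP_one (by omega))).add hb
  one_mem' := by
    rw [Set.mem_ofPred_eq, mat_one, sub_self]
    exact ⟨InP.zero _, InP.zero _, InP.zero _, InP.zero _⟩
  inv_mem' := by
    intro a (ha : S.Lat m n (mat a - 1))
    rw [Set.mem_ofPred_eq, mat_inv, starInv_sub_one]
    exact ha.starInv

/-- The congruence subgroup `K_k`. -/
def Ksub (k : ℕ) : Subgroup S.Kgrp where
  carrier := {g | S.MatInP k (mat g - 1)}
  mul_mem' := by
    intro a b (ha : S.MatInP k (mat a - 1)) (hb : S.MatInP k (mat b - 1))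
    have e : mat (a * b) - 1 = (mat a - 1) * mat b + (mat b - 1) := by
      rw [mat_mul, sub_mul, one_mul, sub_add_sub_cancel]
    rw [Set.mem_ofPred_eq, e]
    exact (by simpa using ha.mul (kset_inP (mat_mem b)) : S.MatInP k ((mat a - 1) * mat b)).add hb
  one_mem' := by
    rw [Set.mem_ofPred_eq, mat_one, sub_self]
    exact fun i j => InP.zero _
  inv_mem' := by
    intro a (ha : S.MatInP k (mat a - 1))
    rw [Set.mem_ofPred_eq, mat_inv, starInv_sub_one]
    exact ha.starInv

/-- The defining congruences of `T(X)·J_d`, where `w = v/u`. -/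
def HCond (w : E) (m n : ℤ) (g : Mat E) : Prop :=
  S.InP n (g 1 0 - g 0 1 * w) ∧ S.InP m (g 0 0 - g 1 1)

/-- The subgroup of `K` cut out by `HCond`. -/
def Hsub {w : E} {m n : ℕ} (hw : S.sig w = w) (hw1 : S.InP 1 w) (hmn : m ≤ n)
    (hnm : n ≤ m + 1) : Subgroup S.Kgrp where
  carrier := {g | S.HCond w m n (mat g)}
  mul_mem' := by
    intro a b (ha : S.HCond w m n (mat a)) (hb : S.HCond w m n (mat b))
    have hA := (kset_inP (mat_mem a))
    have hB := (kset_inP (mat_mem b))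
    rw [Set.mem_ofPred_eq, mat_mul]
    simp only [HCond, mul_apply_two]
    have hw' : ∀ {x : E}, S.InP m x → S.InP n (x * w) := fun hx =>
      (hx.mul hw1).mono (by omega)
    constructor
    · have := (((ha.1.mul_right (hB 0 0)).add (hb.1.mul_left (hA 1 1))).add
        ((hw' hb.2).mul_left (hA 0 1))).sub ((hw' ha.2).mul_right (hB 0 1))
      convert this using 1
      ring
    · have hmn' : (m : ℤ) ≤ n := by omega
      have := (((ha.2.mul_right (hB 0 0)).add (hb.2.mul_left (hA 1 1))).add
        ((hb.1.mono hmn').mul_left (hA 0 1))).sub ((ha.1.mono hmn').mul_right (hB 0 1))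
      convert this using 1
      ring
  one_mem' := by
    rw [Set.mem_ofPred_eq, mat_one]
    constructor
    · simpa using InP.zero _
    · simpa using InP.zero _
  inv_mem' := by
    intro a (ha : S.HCond w m n (mat a))
    rw [Set.mem_ofPred_eq, mat_inv]
    constructor
    · simpa [starInv, hw] using ha.1.sig
    · simpa [starInv] using ha.2.sub_comm.sig

end Groups

end USetting

namespace USetting

section Structure

variable {S : USetting E} {g h : Mat E} {w : E} {m n : ℕ}

/-- `N(a) + wN(b)` for the first row `(a, b)` of `g`. -/
def rowNorm (S : USetting E) (w : E) (g : Mat E) : E :=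
  g 0 0 * S.sig (g 0 0) + w * (g 0 1 * S.sig (g 0 1))

theorem sig_rowNorm (hw : S.sig w = w) : S.sig (S.rowNorm w g) = S.rowNorm w g := by
  simp only [rowNorm, map_add, map_mul, S.sig_invol, hw]
  ring

theorem nu_rowNorm (hw1 : S.InP 1 w) (hg : g ∈ Kset S) (ha : S.nu (g 0 0) = 0) :
    S.nu (S.rowNorm w g) = 0 := by
  refine nu_eq_zero_of_sub (nu_unit_mul ha ((S.nu_sig _).trans ha)) ?_
  rw [rowNorm, sub_add_cancel_left]
  exact (hw1.mul_right ((kset_inP hg 0 1).mul_right (kset_inP hg 0 1).sig)).neg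

/-- In an Iwahori element the upper left entry is a unit. -/
theorem nu_upper_left (hg : g ∈ Kset S) (hc : S.InP 1 (g 1 0)) : S.nu (g 0 0) = 0 := by
  have h := kset_inP hg
  refine nu_left_of_mul (h 0 0) (h 1 1).sig (nu_eq_zero_of_sub nu_one ?_)
  rw [← (kset_relations' hg).1, add_sub_cancel_left]
  exact hc.sig.mul_left (h 0 1)

theorem nu_lower_right (hg : g ∈ Kset S) (hc : S.InP 1 (g 1 0)) : S.nu (g 1 1) = 0 := by
  have := nu_upper_left (kset_starInv hg) hc.sig
  exact (S.nu_sig _).symm.trans this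

theorem HCond.inP_one (hw1 : S.InP 1 w) (hn : 1 ≤ n) (hg : g ∈ Kset S)
    (hH : S.HCond w m n g) : S.InP 1 (g 1 0) := by
  simpa using (hH.1.mono (by omega : (1 : ℤ) ≤ n)).add (hw1.mul_left (kset_inP hg 0 1))

theorem hCond_of_mul {t j : Mat E} (hw1 : S.InP 1 w) (hmn : m ≤ n) (hnm : n ≤ m + 1)
    (ht : t ∈ Kset S) (ht1 : t 1 1 = t 0 0) (ht2 : t 1 0 = t 0 1 * w)
    (hj : S.Lat m n (j - 1)) : S.HCond w m n (t * j) := by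
  obtain ⟨h1, h2, h3, h4⟩ := hj
  simp at h1 h2 h3 h4
  have hT := kset_inP ht
  have hd : S.InP m (j 0 0 - j 1 1) := by
    convert h1.sub h3 using 1
    ring
  have hmn' : (m : ℤ) ≤ n := by omega
  have hw' : ∀ {x : E}, S.InP m x → S.InP n (x * w) := fun hx =>
    (hx.mul hw1).mono (by omega)
  simp only [HCond, mul_apply_two, ht1, ht2]
  constructor
  · convert (((hw' hd).mul_left (hT 0 1)).add (h4.mul_left (hT 0 0))).sub
      ((hw' h2).mul_left (hT 0 0)) using 1
    ring
  · convert ((hd.mul_left (hT 0 0)).add ((h4.mono hmn').mul_left (hT 0 1))).sub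
      (((hw' h2).mono hmn').mul_left (hT 0 1)) using 1
    ring

/-- An element satisfying `HCond` factors as a commuting element times a congruence element. -/
theorem HCond.exists_factor (hw : S.sig w = w) (hw1 : S.InP 1 w) (hm : 1 ≤ m) (hmn : m ≤ n)
    (hnm : n ≤ m + 1) (hg : g ∈ Kset S) (hH : S.HCond w m n g) :
    ∃ t ∈ Kset S, t 1 1 = t 0 0 ∧ t 1 0 = t 0 1 * w ∧
      ∃ j ∈ Kset S, S.Lat m n (j - 1) ∧ g = t * j := by
  have hI := kset_inP hg
  have hc := hH.inP_one hw1 (by omega) hg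
  have ha := nu_upper_left hg hc
  have hN := nu_rowNorm hw1 hg ha
  have hN0 := ne_zero_of_nu hN
  have hmn' : (m : ℤ) ≤ n := by omega
  have hN1 : S.InP m (S.rowNorm w g - 1) := by
    have := (hH.2.mul_left (hI 0 0).sig).sub ((hH.1.sig.mono hmn').mul_left (hI 0 1))
    convert this using 1
    rw [rowNorm, map_sub, map_mul, hw]
    linear_combination (kset_relations hg).2.2.2
  obtain ⟨r, hr, hr1, hrr⟩ := exists_sqrt (S := S) (y := (S.rowNorm w g)⁻¹) hm
    (by rw [sig_inv, sig_rowNorm hw]) (by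
      rw [← inP_mul_unit_iff hN, sub_mul, inv_mul_cancel₀ hN0, one_mul]
      exact hN1.sub_comm)
  have hr0 : S.InP 0 r := by
    simpa using (hr1.mono (by omega : (0 : ℤ) ≤ m)).add InP.one
  have hrN : r * r * S.rowNorm w g = 1 := by rw [hrr, inv_mul_cancel₀ hN0]
  rw [rowNorm] at hrN
  let t : Mat E := !![r * g 0 0, r * g 0 1; r * g 0 1 * w, r * g 0 0]
  have hab := (kset_relations' hg).2.1
  have htK : t ∈ Kset S := by
    refine mem_Kset_iff.2 ⟨?_, ?_⟩
    · ext i j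
      fin_cases i <;> fin_cases j <;> simp [t, starInv, mul_apply_two, hr, hw]
      · linear_combination hrN
      · linear_combination r * r * hab
      · linear_combination r * r * w * hab
      · linear_combination hrN
    · intro i j
      fin_cases i <;> fin_cases j
      exacts [hr0.mul_right (hI 0 0), hr0.mul_right (hI 0 1),
        (hr0.mul_right (hI 0 1)).mul_right (hw1.mono zero_le_one), hr0.mul_right (hI 0 0)]
  have ht1 : S.InP 1 (t 1 0) := hw1.mul_left (hr0.mul_right (hI 0 1))
  refine ⟨t, htK, rfl, rfl, S.starInv t * g, kset_mul (kset_starInv htK) hg, ?_, ?_⟩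
  · have e : S.starInv t * g - 1 = S.starInv t * (g - t) := by
      rw [mul_sub, kset_starInv_mul_self htK]
    rw [e]
    refine Lat.mul_left ?_ hmn' (by omega) (kset_inP (kset_starInv htK)) ht1.sig
    have hr1' := hr1.sub_comm
    refine ⟨?_, ?_, ?_, ?_⟩
    · convert hr1'.mul_right (hI 0 0) using 1
      simp [t]
      ring
    · convert hr1'.mul_right (hI 0 1) using 1
      simp [t]
      ring
    · convert (hr1'.mul_right (hI 0 0)).sub hH.2 using 1
      simp [t]
      ring
    · convert hH.1.add (((hr1'.mul hw1).mono (by omega)).mul_right (hI 0 1)) using 1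
      simp [t]
      ring
  · rw [← Matrix.mul_assoc, kset_mul_starInv_self htK, one_mul]

theorem mem_TXJ_iff {d : ℕ} (hd : 0 < d) {u v : E} (hw : S.sig (u⁻¹ * v) = u⁻¹ * v)
    (hw1 : S.InP 1 (u⁻¹ * v)) : g ∈ TXJ S u v d ↔
      g ∈ Kset S ∧ S.HCond (u⁻¹ * v) ((d + 1) / 2 : ℕ) (d / 2 + 1 : ℕ) g := by
  constructor
  · rintro ⟨t, ⟨ht, ht1, ht2⟩, j, hj, rfl⟩
    obtain ⟨hjK, hj⟩ := mem_Jgrp_iff.1 hj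
    exact ⟨kset_mul ht hjK, hCond_of_mul hw1 (by omega) (by omega) ht ht1 ht2 hj⟩
  · rintro ⟨hg, hH⟩
    obtain ⟨t, ht, ht1, ht2, j, hj, hjl, e⟩ :=
      hH.exists_factor hw hw1 (by omega) (by omega) (by omega) hg
    exact ⟨t, ⟨ht, ht1, ht2⟩, j, mem_Jgrp_iff.2 ⟨hj, hjl⟩, e⟩

/-! ### Coset representatives -/

/-- The lower triangular matrix `[[1,0],[y√ε,1]]·diag(α, σ(α)⁻¹)`. -/
def lowerRep (S : USetting E) (α y : E) : Mat E :=
  !![α, 0; y * S.sqeps * α, (S.sig α)⁻¹]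

theorem lowerRep_mem {α y : E} (hα : S.nu α = 0) (hy : S.sig y = y) (hy0 : S.InP 0 y) :
    S.lowerRep α y ∈ Kset S := by
  have hα0 := ne_zero_of_nu hα
  have hα0' : S.sig α ≠ 0 := ne_zero_of_nu ((S.nu_sig α).trans hα)
  refine mem_Kset_iff.2 ⟨?_, ?_⟩
  · ext i j
    fin_cases i <;> fin_cases j <;>
      simp [lowerRep, starInv, mul_apply_two, hy, S.sig_sqeps, S.sig_invol, hα0, hα0']
    ring
  · intro i j
    fin_cases i <;> fin_cases j
    exacts [.of_nu_eq_zero hα, InP.zero 0,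
      (hy0.mul_right InP.sqeps).mul_right (.of_nu_eq_zero hα),
      .of_nu_eq_zero (nu_inv_unit ((S.nu_sig α).trans hα))]

theorem w0_mem : w0 E ∈ Kset S := by
  refine mem_Kset_iff.2 ⟨?_, ?_⟩
  · ext i j
    fin_cases i <;> fin_cases j <;> simp [w0, starInv, mul_apply_two]
  · intro i j
    fin_cases i <;> fin_cases j
    exacts [InP.zero 0, InP.one, InP.one, InP.zero 0]

/-- The lower unipotent coordinate of the coset of `g`. -/
def cosetCoord (S : USetting E) (w : E) (g : Mat E) : E :=
  (g 1 0 - g 0 1 * w * (S.rowNorm w g)⁻¹) * (g 0 0)⁻¹ * S.sqeps⁻¹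

theorem sig_cosetCoord (hw : S.sig w = w) (hg : g ∈ Kset S) (ha : S.nu (g 0 0) = 0) :
    S.sig (S.cosetCoord w g) = S.cosetCoord w g := by
  have ha0 := ne_zero_of_nu ha
  have ha0' : S.sig (g 0 0) ≠ 0 := ne_zero_of_nu ((S.nu_sig _).trans ha)
  have h1 : S.sig (g 1 0) = -(S.sig (g 0 0) * g 1 0 * (g 0 0)⁻¹) := by
    field_simp
    linear_combination (kset_relations hg).2.2.1
  have h2 : S.sig (g 0 1) = -(S.sig (g 0 0) * g 0 1 * (g 0 0)⁻¹) := by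
    field_simp
    linear_combination (kset_relations' hg).2.1
  simp only [cosetCoord, map_mul, map_sub, sig_inv, sig_rowNorm hw, S.sig_sqeps, hw, h1, h2]
  field_simp
  ring

theorem inP_cosetCoord (hw1 : S.InP 1 w) (hg : g ∈ Kset S) (ha : S.nu (g 0 0) = 0) {k : ℤ}
    (hk : k ≤ 1) (hc : S.InP k (g 1 0)) : S.InP k (S.cosetCoord w g) := by
  rw [cosetCoord, inP_mul_unit_iff (nu_inv_unit S.nu_sqeps), inP_mul_unit_iff (nu_inv_unit ha)]
  refine hc.sub ?_
  rw [inP_mul_unit_iff (nu_inv_unit (nu_rowNorm hw1 hg ha))]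
  exact (hw1.mono hk).mul_left (kset_inP hg 0 1)

/-- The coset of `g` with unit upper left entry is determined by `rowNorm` and `cosetCoord`. -/
theorem hCond_lowerRep_iff (hw1 : S.InP 1 w) (hm : 1 ≤ m) (hmn : m ≤ n)
    (hnm : n ≤ m + 1) (hg : g ∈ Kset S) (ha : S.nu (g 0 0) = 0) {α y : E}
    (hα : S.nu α = 0) (hy : S.sig y = y) (hy0 : S.InP 0 y) :
    S.HCond w m n (S.starInv (S.lowerRep α y) * g) ↔
      S.InP m (S.rowNorm w g - α * S.sig α) ∧ S.InP n (S.cosetCoord w g - y) := by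
  have hI := kset_inP hg
  have ha0 := ne_zero_of_nu ha
  have hα0 := ne_zero_of_nu hα
  have hασ : S.nu (S.sig α) = 0 := (S.nu_sig α).trans hα
  have hN := nu_rowNorm hw1 hg ha
  have hN0 := ne_zero_of_nu hN
  have haσ0 : S.sig (g 0 0) ≠ 0 := ne_zero_of_nu ((S.nu_sig _).trans ha)
  set Y₀ := S.cosetCoord w g * S.sqeps with hY₀
  set Y := y * S.sqeps with hY
  set N := S.rowNorm w g with hNdef
  set M := α * S.sig α with hM
  have hMu : S.nu M = 0 := nu_unit_mul hα hασ
  have hY0 : S.InP 0 Y := hy0.mul_right InP.sqeps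
  have hmn' : (m : ℤ) ≤ n := by omega
  have e1 : N * (g 1 0 - Y₀ * g 0 0) = g 0 1 * w := by
    have hs := S.sqeps_ne_zero
    rw [hY₀, cosetCoord, ← hNdef]
    field_simp
    ring
  have hdet : S.sig (g 0 0) * (g 0 0 * g 1 1 - g 0 1 * g 1 0) = g 0 0 := by
    linear_combination g 0 0 * (kset_relations hg).2.2.2 - g 0 1 * (kset_relations hg).2.2.1
  have e2 : N * (g 1 1 - Y₀ * g 0 1) = g 0 0 := by
    have h3 : g 0 0 * S.sig (g 0 0) * (N * (g 1 1 - Y₀ * g 0 1)) =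
        g 0 0 * S.sig (g 0 0) * g 0 0 := by
      have h4 : N = g 0 0 * S.sig (g 0 0) + w * (g 0 1 * S.sig (g 0 1)) := rfl
      linear_combination N * hdet + S.sig (g 0 0) * g 0 1 * e1 + g 0 0 * h4 +
        w * g 0 1 * (kset_relations' hg).2.1
    exact mul_left_cancel₀ (mul_ne_zero ha0 haσ0) h3
  have hD : S.nu (g 0 0 * g 1 1 - g 0 1 * g 1 0) = 0 := by
    rw [← Matrix.det_fin_two]
    exact hg.2.2
  have c1 : S.InP n ((S.starInv (S.lowerRep α y) * g) 1 0 -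
        (S.starInv (S.lowerRep α y) * g) 0 1 * w) ↔
      S.InP n ((M - N) * (g 1 0 - Y * g 0 0) - N * g 0 0 * (Y - Y₀)) := by
    rw [← inP_unit_mul_iff hα]
    have : α * ((S.starInv (S.lowerRep α y) * g) 1 0 -
        (S.starInv (S.lowerRep α y) * g) 0 1 * w) =
        (M - N) * (g 1 0 - Y * g 0 0) - N * g 0 0 * (Y - Y₀) := by
      simp only [lowerRep, starInv, mul_apply_two, of_apply, cons_val', cons_val_zero, cons_val_one,
        cons_val_fin_one, map_mul, map_zero, hy, S.sig_sqeps, S.sig_invol, sig_inv]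
      field_simp
      linear_combination e1
    rw [this]
  have c2 : S.InP m ((S.starInv (S.lowerRep α y) * g) 0 0 -
        (S.starInv (S.lowerRep α y) * g) 1 1) ↔
      S.InP m (N * g 0 1 * (Y - Y₀) - (M - N) * (g 1 1 - Y * g 0 1)) := by
    rw [← inP_unit_mul_iff hα]
    have : α * ((S.starInv (S.lowerRep α y) * g) 0 0 -
        (S.starInv (S.lowerRep α y) * g) 1 1) =
        N * g 0 1 * (Y - Y₀) - (M - N) * (g 1 1 - Y * g 0 1) := by
      simp only [lowerRep, starInv, mul_apply_two, of_apply, cons_val', cons_val_zero, cons_val_one,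
        cons_val_fin_one, map_mul, map_zero, hy, S.sig_sqeps, S.sig_invol, sig_inv]
      field_simp
      linear_combination -e2
    rw [this]
  have c3 : S.InP n (S.cosetCoord w g - y) ↔ S.InP n (Y - Y₀) := by
    rw [← inP_mul_unit_iff S.nu_sqeps, sub_mul]
    exact ⟨InP.sub_comm, InP.sub_comm⟩
  rw [HCond, c1, c2, c3]
  have hN' := InP.of_nu_eq_zero hN
  constructor
  · rintro ⟨h1, h2⟩
    have hMN : S.InP m (M - N) := by
      rw [← inP_mul_unit_iff hD]
      convert (((h1.mono hmn').mul_right (hI 0 1)).add (h2.mul_right (hI 0 0))).neg using 1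
      ring
    have hcY : S.InP 1 (g 1 0 - Y * g 0 0) := by
      rw [← inP_unit_mul_iff hMu]
      convert (h1.mono (by omega : (1 : ℤ) ≤ n)).add (hw1.mul_left (hI 0 1)) using 1
      linear_combination e1
    refine ⟨hMN.sub_comm, ?_⟩
    rw [← inP_unit_mul_iff (nu_unit_mul hN ha)]
    convert ((hMN.mul hcY).mono (by omega)).sub h1 using 1
    ring
  · rintro ⟨h1, h2⟩
    have hcY : S.InP 1 (g 1 0 - Y * g 0 0) := by
      rw [← inP_unit_mul_iff hN]
      convert (hw1.mul_left (hI 0 1)).sub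
        ((h2.mono (by omega : (1 : ℤ) ≤ n)).mul_left (hN'.mul_right (hI 0 0))) using 1
      linear_combination e1
    have hMN := h1.sub_comm
    exact ⟨((hMN.mul hcY).mono (by omega)).sub (h2.mul_left (hN'.mul_right (hI 0 0))),
      ((h2.mono hmn').mul_left (hN'.mul_right (hI 0 1))).sub
        (hMN.mul_right ((hI 1 1).sub (hY0.mul_right (hI 0 1))))⟩

end Structure

end USetting

namespace USetting

section Cosets

variable {S : USetting E} {g : Mat E} {w : E} {m n : ℕ}

theorem starInv_w0 : S.starInv (w0 E) = w0 E := by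
  ext i j
  fin_cases i <;> fin_cases j <;> simp [w0, starInv]

/-- The elements of `K` whose upper left entry is a unit and whose lower left entry lies in
`p_E^k`, `k ≤ 1`, have unique representatives of the form `lowerRep`. -/
theorem existsUnique_lowerRep (hw : S.sig w = w) (hw1 : S.InP 1 w) (hm : 1 ≤ m) (hmn : m ≤ n)
    (hnm : n ≤ m + 1) {k : ℤ} (hk0 : 0 ≤ k) (hk : k ≤ 1) {T₁ T₂ : Finset E}
    (hT₁ : S.IsTransversal (OFunits S) m T₁) (hT₂ : S.IsTransversal (S.idealF k) n T₂)
    {α : T₁ → E} (hα : ∀ t, S.nu (α t) = 0) (hαt : ∀ t, α t * S.sig (α t) = t)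
    (hg : g ∈ Kset S) (ha : S.nu (g 0 0) = 0) (hc : S.InP k (g 1 0)) :
    ∃! p : T₁ × T₂, S.HCond w m n (S.starInv (S.lowerRep (α p.1) p.2) * g) := by
  have key : ∀ p : T₁ × T₂, S.HCond w m n (S.starInv (S.lowerRep (α p.1) p.2) * g) ↔
      S.InP m (S.rowNorm w g - p.1) ∧ S.InP n (S.cosetCoord w g - p.2) := by
    intro p
    have hp := hT₂.1 _ p.2.2
    rw [hCond_lowerRep_iff hw1 hm hmn hnm hg ha (hα p.1) hp.1 (hp.2.mono hk0), hαt]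
  obtain ⟨t, ⟨ht, ht'⟩, htu⟩ := hT₁.2 _ ⟨sig_rowNorm (g := g) hw, nu_rowNorm hw1 hg ha⟩
  obtain ⟨y, ⟨hy, hy'⟩, hyu⟩ :=
    hT₂.2 _ ⟨sig_cosetCoord hw hg ha, inP_cosetCoord hw1 hg ha hk hc⟩
  refine ⟨(⟨t, ht⟩, ⟨y, hy⟩), (key _).2 ⟨ht', hy'⟩, fun p hp => ?_⟩
  obtain ⟨h1, h2⟩ := (key p).1 hp
  exact Prod.ext (Subtype.ext (htu _ ⟨p.1.2, h1⟩)) (Subtype.ext (hyu _ ⟨p.2.2, h2⟩))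

theorem inP_of_hCond_lowerRep (hw1 : S.InP 1 w) (hn : 1 ≤ n) (hg : g ∈ Kset S) {α y : E}
    (hα : S.nu α = 0) (hy : S.sig y = y) (hy0 : S.InP 0 y)
    (h : S.HCond w m n (S.starInv (S.lowerRep α y) * g)) :
    S.InP 1 (g 1 0 - y * S.sqeps * g 0 0) := by
  have h1 := h.inP_one hw1 hn (kset_mul (kset_starInv (lowerRep_mem hα hy hy0)) hg)
  rw [← inP_unit_mul_iff ((S.nu_sig α).trans hα)]
  convert h1 using 1
  simp [lowerRep, starInv, mul_apply_two, hy, S.sig_sqeps]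
  ring

/-- Left coset representatives for `Hsub`. -/
theorem existsUnique_cosetRep (hw : S.sig w = w) (hw1 : S.InP 1 w) (hm : 1 ≤ m) (hmn : m ≤ n)
    (hnm : n ≤ m + 1) {T T₀ T₁ : Finset E} (hT : S.IsTransversal (OFunits S) m T)
    (hT₀ : S.IsTransversal (S.idealF 0) n T₀) (hT₁ : S.IsTransversal (S.idealF 1) n T₁)
    {α : T → E} (hα : ∀ t, S.nu (α t) = 0) (hαt : ∀ t, α t * S.sig (α t) = t)
    (hg : g ∈ Kset S) :
    ∃! i : T × T₀ ⊕ T × T₁, S.HCond w m n (S.starInv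
      (Sum.elim (fun p => S.lowerRep (α p.1) p.2) (fun p => w0 E * S.lowerRep (α p.1) p.2) i) *
        g) := by
  have hI := kset_inP hg
  have hwg : w0 E * g ∈ Kset S := kset_mul w0_mem hg
  have e : ∀ L : Mat E, S.starInv (w0 E * L) * g = S.starInv L * (w0 E * g) := by
    intro L
    rw [starInv_mul, starInv_w0, Matrix.mul_assoc]
  have e00 : (w0 E * g) 0 0 = g 1 0 := by simp [w0, mul_apply_two]
  have e10 : (w0 E * g) 1 0 = g 0 0 := by simp [w0, mul_apply_two]
  by_cases ha : S.nu (g 0 0) = 0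
  · obtain ⟨p, hp, hpu⟩ := existsUnique_lowerRep hw hw1 hm hmn hnm le_rfl zero_le_one hT hT₀ hα hαt
      hg ha (hI 1 0)
    refine ⟨Sum.inl p, hp, ?_⟩
    rintro (p' | p') h
    · exact congrArg _ (hpu p' h)
    · exfalso
      have hp' := hT₁.1 _ p'.2.2
      simp only [Sum.elim_inr, e] at h
      have h1 := inP_of_hCond_lowerRep hw1 (by omega) hwg (hα p'.1) hp'.1
        (hp'.2.mono zero_le_one) h
      rw [e00, e10] at h1
      refine not_inP_one_of_nu ha ?_
      simpa using h1.add ((hp'.2.mul_right InP.sqeps).mul_right (hI 1 0))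
  · have ha1 : S.InP 1 (g 0 0) := by
      by_contra h
      exact ha ((nu_eq_zero_iff (hI 0 0)).2 h)
    have hc : S.nu (g 1 0) = 0 :=
      (nu_eq_zero_iff (hI 1 0)).2 fun h => ha (nu_upper_left hg h)
    obtain ⟨p, hp, hpu⟩ := existsUnique_lowerRep hw hw1 hm hmn hnm zero_le_one le_rfl hT hT₁ hα hαt
      hwg (e00 ▸ hc) (e10 ▸ ha1)
    refine ⟨Sum.inr p, by simpa only [Sum.elim_inr, e] using hp, ?_⟩
    rintro (p' | p') h
    · exfalso
      have hp' := hT₀.1 _ p'.2.2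
      have h1 := inP_of_hCond_lowerRep hw1 (by omega) hg (hα p'.1) hp'.1 hp'.2 h
      refine not_inP_one_of_nu hc ?_
      simpa using h1.add (ha1.mul_left (hp'.2.mul_right InP.sqeps))
    · simp only [Sum.elim_inr, e] at h
      exact congrArg _ (hpu p' h)

theorem exists_cosetReps (hw : S.sig w = w) (hw1 : S.InP 1 w) (hm : 1 ≤ m) (hmn : m ≤ n)
    (hnm : n ≤ m + 1) : ∃ (ι : Type) (_ : Fintype ι) (s : ι → S.Kgrp),
      (∀ g, ∃! i, g * s i ∈ S.Hsub hw hw1 hmn hnm) ∧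
      Fintype.card ι = (S.q - 1) * S.q ^ (m - 1) * (S.q ^ n + S.q ^ (n - 1)) := by
  obtain ⟨T, hTc, hT⟩ := S.exists_unit_transversal (m - 1)
  obtain ⟨T₀, hT₀c, hT₀⟩ := S.exists_transversal 0 n
  obtain ⟨T₁, hT₁c, hT₁⟩ := S.exists_transversal 1 (n - 1)
  rw [show ((m - 1 : ℕ) : ℤ) + 1 = m by omega] at hT
  rw [zero_add] at hT₀
  rw [show 1 + ((n - 1 : ℕ) : ℤ) = n by omega] at hT₁
  have hα : ∀ t : T, ∃ α, S.nu α = 0 ∧ α * S.sig α = t := fun t =>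
    exists_norm_eq (hT.1 _ t.2).1 (hT.1 _ t.2).2
  choose α hα hαt using hα
  have hs : ∀ i : T × T₀ ⊕ T × T₁, Sum.elim (fun p => S.lowerRep (α p.1) p.2)
      (fun p => w0 E * S.lowerRep (α p.1) p.2) i ∈ Kset S := by
    rintro (p | p)
    · exact lowerRep_mem (hα _) (hT₀.1 _ p.2.2).1 (hT₀.1 _ p.2.2).2
    · exact kset_mul w0_mem
        (lowerRep_mem (hα _) (hT₁.1 _ p.2.2).1 ((hT₁.1 _ p.2.2).2.mono zero_le_one))
  refine ⟨T × T₀ ⊕ T × T₁, inferInstance, fun i => ofMat _ (hs i), fun g => ?_, ?_⟩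
  · have e : ∀ i, g * ofMat _ (hs i) ∈ S.Hsub hw hw1 hmn hnm ↔
        S.HCond w m n (S.starInv (Sum.elim (fun p => S.lowerRep (α p.1) p.2)
          (fun p => w0 E * S.lowerRep (α p.1) p.2) i) * mat g⁻¹) := by
      intro i
      rw [← inv_mem_iff, _root_.mul_inv_rev]
      change S.HCond w m n (mat _) ↔ _
      rw [mat_mul, mat_inv (ofMat _ _), mat_ofMat]
    simp only [e]
    exact existsUnique_cosetRep hw hw1 hm hmn hnm hT hT₀ hT₁ hα hαt (mat_mem _)
  · simp only [Fintype.card_sum, Fintype.card_prod, Fintype.card_coe, hTc, hT₀c, hT₁c]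
    ring

/-- `O_E / p_E^k` is finite. -/
theorem exists_finset_residues (k : ℕ) :
    ∃ R : Finset E, ∀ x, S.InP 0 x → ∃ r ∈ R, S.InP k (x - r) := by
  classical
  obtain ⟨T, -, hT⟩ := S.exists_transversal 0 k
  rw [zero_add] at hT
  refine ⟨Finset.image₂ (fun a b => a + b * S.sqeps) T T, fun x hx => ?_⟩
  have h2 := S.two_ne_zero'
  have hs := S.sqeps_ne_zero
  obtain ⟨a, ⟨ha, ha'⟩, -⟩ := hT.2 ((x + S.sig x) / 2)
    ⟨by simp [S.sig_invol, sig_two, add_comm], (hx.add hx.sig).half⟩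
  obtain ⟨b, ⟨hb, hb'⟩, -⟩ := hT.2 ((x - S.sig x) / 2 * S.sqeps⁻¹) ⟨by
    simp only [map_mul, map_div₀, map_sub, S.sig_invol, sig_two, map_inv₀, S.sig_sqeps]
    field_simp
    ring, by
    rw [inP_mul_unit_iff (nu_inv_unit S.nu_sqeps)]
    exact (hx.sub hx.sig).half⟩
  refine ⟨_, Finset.mem_image₂_of_mem ha hb, ?_⟩
  convert ha'.add (hb'.mul_right InP.sqeps) using 1
  field_simp
  ring

instance finite_quotient_Ksub (k : ℕ) : Finite (S.Kgrp ⧸ S.Ksub k) := by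
  obtain ⟨R, hR⟩ := S.exists_finset_residues k
  have hR' : ∀ (g : S.Kgrp) (i j : Fin 2), ∃ r : R, S.InP k (mat g i j - r) := fun g i j =>
    let ⟨r, hr, h⟩ := hR _ (kset_inP (mat_mem g) i j)
    ⟨⟨r, hr⟩, h⟩
  choose r hr using hR'
  refine Finite.of_injective (fun a : S.Kgrp ⧸ S.Ksub k => r a.out) fun a b hab => ?_
  rw [← QuotientGroup.out_eq' a, ← QuotientGroup.out_eq' b, QuotientGroup.eq]
  have hsub : S.MatInP k (mat b.out - mat a.out) := fun i j => by
    have h1 := hr a.out i j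
    rw [show r a.out i j = r b.out i j from congrFun (congrFun hab i) j] at h1
    simpa using (hr b.out i j).sub h1
  have e : mat (a.out⁻¹ * b.out) - 1 = mat a.out⁻¹ * (mat b.out - mat a.out) := by
    rw [mat_mul, mul_sub, ← mat_mul _ a.out, inv_mul_cancel, mat_one]
  change S.MatInP k (mat (a.out⁻¹ * b.out) - 1)
  rw [e]
  simpa using MatInP.mul (n := 0) (kset_inP (mat_mem a.out⁻¹)) hsub

end Cosets

end USetting

namespace USetting

section Intertwining

variable {S : USetting E} {g : Mat E} {w : E} {m n d : ℕ}

/-- An element of `E` is small if a fixed multiple of it pairs trivially with `p_F^k`. -/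
theorem inP_of_psiE_eq_one {b x : E} {k l : ℤ} (hb : S.nu b = l) (hfix : S.sig (b * x) = b * x)
    (h : ∀ t, S.sig t = t → S.InP k t → psiE S (b * x * t) = 1) : S.InP (1 - k - l) x := by
  rw [← inP_mul_iff hb]
  refine inP_of_psi'_eq_one hfix fun t ht htk => ?_
  rw [← psiE_of_fixed (by rw [map_mul, hfix, ht])]
  exact h t ht htk

theorem upper_mem {t : E} (ht : S.sig t = t) (ht0 : S.InP 0 t) :
    !![1, t * S.sqeps; 0, 1] ∈ Kset S := by
  refine mem_Kset_iff.2 ⟨?_, ?_⟩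
  · ext i j
    fin_cases i <;> fin_cases j <;> simp [starInv, mul_apply_two, ht, S.sig_sqeps]
  · intro i j
    fin_cases i <;> fin_cases j
    exacts [InP.one, ht0.mul_right InP.sqeps, InP.zero 0, InP.one]

/-- The change of the character `Ψ_X` under conjugation, with `X = √ε[[z, u],[uw, z]]`. -/
theorem PsiC_conj (hg : g ∈ Kset S) (z u : E) {j : Mat E}
    (h : PsiC S (Xzuv S z u (u * w)) (g * j * S.starInv g) = PsiC S (Xzuv S z u (u * w)) j) :
    psiE S (S.sqeps * u * ((S.sig (g 1 1) * g 1 0 + w * (S.sig (g 0 1) * g 0 0)) *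
        (j 0 0 - j 1 1) +
      (S.sig (g 1 1) * g 1 1 + w * (S.sig (g 0 1) * g 0 1) - 1) * j 1 0 +
      (S.sig (g 1 0) * g 1 0 + w * (S.sig (g 0 0) * g 0 0) - w) * j 0 1)) = 1 := by
  have h1 := psiE_sub_eq_one h
  convert h1 using 2
  have e : g * j * S.starInv g - 1 = g * (j - 1) * S.starInv g := by
    rw [mul_sub, sub_mul, mul_one, kset_mul_starInv_self hg]
  rw [e, ← Matrix.mul_assoc, Matrix.trace_mul_comm]
  obtain ⟨r1, r2, r3, r4⟩ := kset_relations hg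
  obtain ⟨-, r5, r6⟩ := kset_relations' hg
  simp only [Matrix.trace_fin_two, mul_apply_two]
  simp [Xzuv, starInv]
  linear_combination -(z * S.sqeps) * ((j 0 0 - 1) * r1 + j 1 0 * r2 + j 0 1 * r3 +
    (j 1 1 - 1) * r4) - S.sqeps * u * (j 1 1 - 1) * (r6 + w * r5)

/-- Elements intertwining `Ψ_X` on `1 + Lat m n` satisfy `HCond`. -/
theorem hCond_of_intertwines (hw : S.sig w = w) (hw1 : S.InP 1 w) (hm : 1 ≤ m) (hmn : m ≤ n)
    (hnm : n ≤ m + 1) (hd : m + n = d + 1) {z u : E} (hu : S.sig u = u)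
    (hnu : S.nu u = ((-(d : ℤ) : ℤ) : WithTop ℤ)) (hg : g ∈ Kset S)
    (h_intertwine : ∀ j ∈ Kset S, S.Lat m n (j - 1) → S.Lat m n (g * j * S.starInv g - 1) →
      PsiC S (Xzuv S z u (u * w)) (g * j * S.starInv g) = PsiC S (Xzuv S z u (u * w)) j) :
    S.HCond w m n g := by
  have hI := kset_inP hg
  obtain ⟨r1, r2, r3, r4⟩ := kset_relations hg
  obtain ⟨-, r5, r6⟩ := kset_relations' hg
  have hsu : S.nu (S.sqeps * u) = ((-(d : ℤ) : ℤ) : WithTop ℤ) := by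
    rw [S.nu_mul, S.nu_sqeps, hnu, zero_add]
  have hsus : S.nu (S.sqeps * u * S.sqeps) = ((-(d : ℤ) : ℤ) : WithTop ℤ) := by
    rw [S.nu_mul, S.nu_sqeps, hsu, add_zero]
  have hc : S.InP 1 (g 1 0) := by
    have hC := inP_of_psiE_eq_one (k := d) (x := S.sig (g 1 0) * g 1 0 +
      w * (S.sig (g 0 0) * g 0 0) - w) hsus
      (by simp only [map_mul, map_sub, map_add, S.sig_invol, S.sig_sqeps, hu, hw]; ring)
      fun t ht htd => by
        have hj : S.MatInP d (!![1, t * S.sqeps; 0, 1] - 1) := by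
          intro i j
          fin_cases i <;> fin_cases j <;> simp [InP.zero, htd.mul_right InP.sqeps]
        have hjK := upper_mem ht (htd.mono (by omega))
        have := PsiC_conj hg z u (h_intertwine _ hjK (hj.lat (by omega) (by omega))
          ((hj.conj_sub_one hg).lat (by omega) (by omega)))
        convert this using 2
        simp
        ring
    by_contra hn
    have hcu := (nu_eq_zero_iff (hI 1 0)).2 hn
    refine not_inP_one_of_nu (nu_unit_mul ((S.nu_sig _).trans hcu) hcu) ?_
    convert ((hC.mono (by omega)).add hw1).sub
      (hw1.mul_right ((hI 0 0).sig.mul_right (hI 0 0))) using 1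
    ring
  have htest : ∀ j ∈ Kset S, S.Lat m n (j - 1) → _ := fun j hj hjl =>
    PsiC_conj hg z u (h_intertwine j hj hjl (hjl.conj_sub_one (by omega) (by omega) hg hc))
  have hA := inP_of_psiE_eq_one (k := m) (x := S.sig (g 1 1) * g 1 0 +
    w * (S.sig (g 0 1) * g 0 0)) hsu (by
      simp only [map_mul, map_add, S.sig_invol, S.sig_sqeps, hu, hw]
      linear_combination (-S.sqeps * u) * (r6 + w * r5)) fun s hs hsm => by
        have h2 := S.two_ne_zero'
        have hs2 : S.InP m (s / 2) := hsm.half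
        obtain ⟨r, hr, hr1, hrr⟩ := exists_sqrt (S := S) (y := 1 + s / 2 * (s / 2)) hm
          (by simp [hs, sig_two]) (by
            rw [add_sub_cancel_left]
            exact hs2.mul_right (hs2.mono (by omega)))
        have hαs : S.sig (r + s / 2) = r + s / 2 := by simp [hr, hs, sig_two]
        have hαm : S.InP m (r + s / 2 - 1) := by
          convert hr1.add hs2 using 1
          ring
        have hαu : S.nu (r + s / 2) = 0 :=
          nu_eq_zero_of_sub nu_one (hαm.mono (by omega)).sub_comm
        have hαi : (r + s / 2)⁻¹ = r - s / 2 :=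
          inv_eq_of_mul_eq_one_right (by linear_combination hrr)
        have hj : S.Lat m n (S.lowerRep (r + s / 2) 0 - 1) := by
          refine ⟨?_, ?_, ?_, ?_⟩ <;> simp only [lowerRep, Matrix.sub_apply, of_apply, cons_val',
            cons_val_zero, cons_val_one, cons_val_fin_one, Matrix.one_apply_eq, hαs, hαi, ne_eq,
            zero_ne_one, one_ne_zero, not_false_eq_true, Matrix.one_apply_ne, zero_mul, sub_zero,
            InP.zero, hαm]
          convert hr1.sub hs2 using 1
          ring
        have := htest _ (lowerRep_mem hαu (map_zero _) (InP.zero 0)) hj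
        convert this using 2
        simp only [lowerRep, of_apply, cons_val', cons_val_zero, cons_val_one, cons_val_fin_one,
          hαs, hαi]
        field_simp
        ring
  have hB := inP_of_psiE_eq_one (k := n) (x := S.sig (g 1 1) * g 1 1 +
    w * (S.sig (g 0 1) * g 0 1) - 1) hsus
      (by simp only [map_mul, map_sub, map_add, map_one, S.sig_invol, S.sig_sqeps, hu, hw]; ring)
      fun t ht htn => by
        have hj : S.Lat m n (S.lowerRep 1 t - 1) := by
          refine ⟨?_, ?_, ?_, ?_⟩ <;> simp [lowerRep, InP.zero, htn.mul_right InP.sqeps]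
        have := htest _ (lowerRep_mem nu_one ht (htn.mono (by omega))) hj
        convert this using 2
        simp [lowerRep]
        ring
  replace hA := hA.mono (by omega : (n : ℤ) ≤ _)
  replace hB := hB.mono (by omega : (m : ℤ) ≤ _)
  have heu : S.nu (S.sig (g 1 1)) = 0 := (S.nu_sig _).trans (nu_lower_right hg hc)
  have hx : S.InP n (g 1 0 - g 0 1 * w) := by
    have hunit : S.nu (S.sig (g 1 1) * S.sig (g 1 1) - w * (S.sig (g 0 1) * S.sig (g 0 1))) = 0 :=
      nu_eq_zero_of_sub (nu_unit_mul heu heu) (by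
        rw [sub_sub_cancel]
        exact hw1.mul_right ((hI 0 1).sig.mul_right (hI 0 1).sig))
    rw [← inP_unit_mul_iff hunit]
    convert (hA.mul_left (hI 1 1).sig).add
      (((hw1.mul hB).mono (by omega : (n : ℤ) ≤ _)).mul_left (hI 0 1).sig) using 1
    linear_combination (-w * S.sig (g 1 1)) * r2 - w * S.sig (g 0 1) * r1
  refine ⟨hx, InP.sub_comm ?_⟩
  rw [← inP_unit_mul_iff heu]
  convert hB.add ((hx.mono (by omega : (m : ℤ) ≤ n)).mul_left (hI 0 1).sig) using 1
  linear_combination -r1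

end Intertwining

end USetting

namespace USetting

section Transport

variable {S : USetting E}

/-- Extension by zero of functions on `K` to functions on all matrices. -/
def extendK (S : USetting E) : (S.Kgrp → ℂ) →ₗ[ℂ] (Mat E → ℂ) :=
  Function.ExtendByZero.linearMap ℂ mat

theorem extendK_mat (f : S.Kgrp → ℂ) (g : S.Kgrp) : S.extendK f (mat g) = f g :=
  mat_injective.extend_apply f 0 g

theorem extendK_of_notMem (f : S.Kgrp → ℂ) {x : Mat E} (hx : x ∉ Kset S) : S.extendK f x = 0 :=
  Function.extend_apply' f (0 : Mat E → ℂ) x fun ⟨g, hg⟩ => hx (hg ▸ mat_mem g)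

theorem extendK_injective : Function.Injective S.extendK := fun f f' h =>
  funext fun g => by rw [← extendK_mat f, ← extendK_mat f', h]

theorem eq_extendK {f : Mat E → ℂ} (hf : ∀ x, x ∉ Kset S → f x = 0) :
    S.extendK (fun g => f (mat g)) = f := by
  funext x
  by_cases hx : x ∈ Kset S
  · exact extendK_mat (fun g => f (mat g)) (ofMat x hx)
  · rw [extendK_of_notMem _ hx, hf x hx]

theorem rho_extendK (f : S.Kgrp → ℂ) (g : S.Kgrp) :
    rho (mat g) (S.extendK f) = S.extendK (rightTranslate g f) := by
  rw [← eq_extendK (S := S) (f := rho (mat g) (S.extendK f)) fun x hx =>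
    extendK_of_notMem f fun h => hx ?_]
  · congr 1
    funext k
    exact extendK_mat f (k * g)
  · have := kset_mul h (mat_mem g⁻¹)
    rwa [Matrix.mul_assoc, ← mat_mul, mul_inv_cancel, mat_one, mul_one] at this

theorem IndSp_eq_map {A : Set (Mat E)} {H : Subgroup S.Kgrp} (hA : A ⊆ Kset S)
    (hAH : ∀ h, mat h ∈ A ↔ h ∈ H) (Ψ : Mat E → ℂ) :
    IndSp S A Ψ = (indChar H fun h => Ψ (mat h)).map S.extendK := by
  ext f
  constructor
  · rintro ⟨h0, h1⟩
    exact ⟨fun g => f (mat g), fun h hh k => h1 _ ((hAH h).2 hh) _ (mat_mem k), eq_extendK h0⟩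
  · rintro ⟨f, hf, rfl⟩
    refine ⟨fun x => extendK_of_notMem f, fun h hh k hk => ?_⟩
    have := hf (ofMat h (hA hh)) ((hAH _).1 hh) (ofMat k hk)
    rwa [← extendK_mat f, ← extendK_mat f] at this

theorem isIrredRep_map {I : Submodule ℂ (S.Kgrp → ℂ)} (hI : I ≠ ⊥)
    (hinv : ∀ g, ∀ f ∈ I, rightTranslate g f ∈ I)
    (hirr : ∀ U ≤ I, (∀ g, ∀ f ∈ U, rightTranslate g f ∈ U) → U ≠ ⊥ → U = I) :
    IsIrredRep S (I.map S.extendK) := by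
  refine ⟨?_, ?_, fun U hU hUinv => ?_⟩
  · exact fun h => hI
      (Submodule.map_injective_of_injective extendK_injective (h.trans (Submodule.map_bot S.extendK).symm))
  · rintro g hg _ ⟨f, hf, rfl⟩
    exact ⟨_, hinv (ofMat g hg) f hf, (rho_extendK f (ofMat g hg)).symm⟩
  · have hUeq : (U.comap S.extendK).map S.extendK = U :=
      Submodule.map_comap_eq_self (hU.trans LinearMap.map_le_range)
    by_cases h0 : U.comap S.extendK = ⊥
    · left
      rw [← hUeq, h0, Submodule.map_bot]
    · right
      rw [← hUeq]
      congr 1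
      refine hirr _ ?_ (fun g f hf => ?_) h0
      · rw [← Submodule.comap_map_eq_of_injective extendK_injective I]
        exact Submodule.comap_mono hU
      · rw [Submodule.mem_comap, ← rho_extendK]
        exact hUinv _ (mat_mem g) _ hf

end Transport

section Main

variable {S : USetting E} {d : ℕ}

theorem Xzuv_matInP {z u v : E} (hz : S.InP (-d) z) (hu : S.InP (-d) u) (hv : S.InP (-d) v) :
    S.MatInP (-d) (Xzuv S z u v) := by
  intro i j
  fin_cases i <;> fin_cases j
  exacts [hz.mul_right InP.sqeps, hu.mul_right InP.sqeps, hv.mul_right InP.sqeps,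
    hz.mul_right InP.sqeps]

theorem PsiC_eq_one {X g : Mat E} (hX : S.MatInP (-d) X) (hg : S.MatInP (d + 1) (g - 1)) :
    PsiC S X g = 1 := by
  refine psiE_eq_one ?_
  have := hX.mul hg
  rw [neg_add_cancel_left] at this
  rw [Matrix.trace_fin_two]
  exact (this 0 0).add (this 1 1)

theorem card_cosetReps {q m n : ℕ} (hq : 1 ≤ q) (hm : 1 ≤ m) (hn : 1 ≤ n) (hd : m + n = d + 1) :
    (q - 1) * q ^ (m - 1) * (q ^ n + q ^ (n - 1)) = (q ^ 2 - 1) * q ^ (d - 1) := by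
  obtain ⟨r, rfl⟩ := Nat.exists_eq_add_of_le' hq
  obtain ⟨a, rfl⟩ := Nat.exists_eq_add_of_le' hm
  obtain ⟨b, rfl⟩ := Nat.exists_eq_add_of_le' hn
  obtain rfl : d = a + b + 1 := by omega
  have e : (r + 1) ^ 2 - 1 = r * (r + 2) := by
    rw [Nat.sub_eq_iff_eq_add (Nat.one_le_pow _ _ hq)]
    ring
  rw [e]
  simp only [Nat.add_sub_cancel]
  ring

end Main

end USetting

open USetting

/-- if `Ψ′` is a character of `H = T(X)·J_d` restricting to `Ψ_X` on `J_d`,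
then the induced space `S = Ind_H^K Ψ′` is an irreducible `K`-representation of dimension
`(q²−1) q^{d−1}`, on which `K_{d+1}` acts trivially while `K_d` does not. -/
theorem stmt15 (S : USetting E) (d : ℕ) (hd : 0 < d) (z u v : E)
    (hz : S.sig z = z) (hu : S.sig u = u) (hv : S.sig v = v)
    (hnz : ((-(d : ℤ) : ℤ) : WithTop ℤ) ≤ S.nu z)
    (hnu : S.nu u = ((-(d : ℤ) : ℤ) : WithTop ℤ))
    (hnv : ((-(d : ℤ) : ℤ) : WithTop ℤ) < S.nu v)
    (Ψ' : Mat E → ℂ) (hhom : IsHomOn (TXJ S u v d) Ψ')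
    (hres : ∀ j ∈ Jgrp S d, Ψ' j = PsiC S (Xzuv S z u v) j) :
    IsIrredRep S (IndSp S (TXJ S u v d) Ψ') ∧
    Module.finrank ℂ ↥(IndSp S (TXJ S u v d) Ψ') = (S.q ^ 2 - 1) * S.q ^ (d - 1) ∧
    ActsTrivially S (Kfil S ((d : ℤ) + 1)) (IndSp S (TXJ S u v d) Ψ') ∧
    ¬ ActsTrivially S (Kfil S (d : ℤ)) (IndSp S (TXJ S u v d) Ψ') := by
  have hu0 : u ≠ 0 := by
    rintro rfl
    rw [nu_zero] at hnu
    exact WithTop.top_ne_coe hnu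
  have hv1 : S.InP (-d + 1) v := by
    by_cases h0 : v = 0
    · exact h0 ▸ InP.zero _
    · obtain ⟨l, hl⟩ := S.exists_nu_eq h0
      rw [hl] at hnv
      rw [InP, hl]
      norm_cast at hnv ⊢
  have huw : u * (u⁻¹ * v) = v := mul_inv_cancel_left₀ hu0 v
  have hw : S.sig (u⁻¹ * v) = u⁻¹ * v := by rw [map_mul, sig_inv, hu, hv]
  have hw1 : S.InP 1 (u⁻¹ * v) := by
    have := (inP_mul_iff (x := u⁻¹ * v) hnu).1 (huw.symm ▸ hv1)
    exact this.mono (by omega)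
  have hX : S.MatInP (-d) (Xzuv S z u v) := Xzuv_matInP hnz hnu.ge (hv1.mono (by omega))
  obtain ⟨m, hmdef⟩ : ∃ m, m = (d + 1) / 2 := ⟨_, rfl⟩
  obtain ⟨n, hndef⟩ : ∃ n, n = d / 2 + 1 := ⟨_, rfl⟩
  have hm : 1 ≤ m := by omega
  have hmn : m ≤ n := by omega
  have hnm : n ≤ m + 1 := by omega
  have hdmn : m + n = d + 1 := by omega
  have hTXJ : ∀ g, g ∈ TXJ S u v d ↔ g ∈ Kset S ∧ S.HCond (u⁻¹ * v) m n g := by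
    rw [hmdef, hndef]
    exact fun g => mem_TXJ_iff hd hw hw1
  have hJ : ∀ g ∈ Kset S, S.Lat m n (g - 1) → Ψ' g = PsiC S (Xzuv S z u v) g := by
    rw [hmdef, hndef]
    exact fun g hg hl => hres g (mem_Jgrp_iff.2 ⟨hg, hl⟩)
  let H := S.Hsub hw hw1 hmn hnm
  let J := S.Jsub hm hmn hnm
  let N := S.Ksub (d + 1)
  let χ : S.Kgrp → ℂ := fun g => Ψ' (mat g)
  have hAH : ∀ h : S.Kgrp, mat h ∈ TXJ S u v d ↔ h ∈ H := fun h =>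
    (hTXJ _).trans (and_iff_right (mat_mem h))
  have hmul : ∀ x ∈ H, ∀ y ∈ H, χ (x * y) = χ x * χ y := fun x hx y hy =>
    hhom.1 _ ((hAH x).2 hx) _ ((hAH y).2 hy)
  have hne : ∀ x ∈ H, χ x ≠ 0 := fun x hx => hhom.2 _ ((hAH x).2 hx)
  have hNJ : N ≤ J := fun x (hx : S.MatInP (d + 1 : ℕ) (mat x - 1)) =>
    hx.lat (by omega) (by omega)
  have hJH : J ≤ H := fun x (hx : S.Lat m n (mat x - 1)) => by
    have := hCond_of_mul hw1 hmn hnm kset_one rfl (by simp) hx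
    rwa [one_mul] at this
  have hχN : ∀ x ∈ N, χ x = 1 := fun x hx =>
    (hJ _ (mat_mem x) (hNJ hx)).trans (PsiC_eq_one hX (by exact_mod_cast hx))
  have hN : ∀ f ∈ indChar H χ, ∀ x ∈ N, ∀ k, f (k * x) = f k := by
    intro f hf x (hx : S.MatInP (d + 1 : ℕ) (mat x - 1)) k
    have hx' : k * x * k⁻¹ ∈ N := by
      change S.MatInP (d + 1 : ℕ) (mat (k * x * k⁻¹) - 1)
      rw [mat_mul, mat_mul, mat_inv]
      exact hx.conj_sub_one (mat_mem k)
    have := hf _ (hJH (hNJ hx')) k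
    rwa [inv_mul_cancel_right, hχN _ hx', one_mul] at this
  have h_intertwine : ∀ g, (∀ j ∈ J, g * j * g⁻¹ ∈ J → χ (g * j * g⁻¹) = χ j) → g ∈ H := by
    intro g hg
    refine hCond_of_intertwines (z := z) hw hw1 hm hmn hnm hdmn hu hnu (mat_mem g)
      fun j hj hjl hjg => ?_
    have e : mat (g * ofMat j hj * g⁻¹) = mat g * j * S.starInv (mat g) := by
      rw [mat_mul, mat_mul, mat_inv, mat_ofMat]
    have h := hg (ofMat j hj) hjl (by
      change S.Lat m n (mat (g * ofMat j hj * g⁻¹) - 1)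
      rwa [e])
    have hK : mat g * j * S.starInv (mat g) ∈ Kset S := e ▸ mat_mem _
    rw [huw, ← hJ _ hK hjg, ← hJ _ hj hjl, ← e]
    exact h
  obtain ⟨ι, _, s, hs, hcard⟩ := exists_cosetReps hw hw1 hm hmn hnm
  have hW : IndSp S (TXJ S u v d) Ψ' = (indChar H χ).map S.extendK :=
    IndSp_eq_map (fun g hg => ((hTXJ g).1 hg).1) hAH Ψ'
  classical
  let f₀ : S.Kgrp → ℂ := fun g => if g ∈ H then χ g else 0
  have hf₀ : f₀ ∈ indChar H χ := by
    intro h hh k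
    by_cases hk : k ∈ H
    · simp [f₀, hk, H.mul_mem hh hk, hmul h hh k hk]
    · simp [f₀, hk, H.mul_mem_cancel_left hh]
  have hf₀1 : f₀ 1 = 1 := by
    simp [f₀, H.one_mem, char_one_of_mul hmul hne]
  rw [hW]
  refine ⟨isIrredRep_map ?_ ?_ fun U hU hinv hU0 => ?_, ?_, ?_, ?_⟩
  · rw [Submodule.ne_bot_iff]
    refine ⟨f₀, hf₀, fun h => ?_⟩
    rw [h] at hf₀1
    exact zero_ne_one hf₀1
  · intro g f hf h hh k
    rw [rightTranslate, rightTranslate, _root_.mul_assoc, hf h hh]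
  · exact indChar_irreducible s hs hNJ hJH hmul hne hχN hN h_intertwine hU hinv hU0
  · rw [← (Submodule.equivMapOfInjective _ extendK_injective (indChar H χ)).finrank_eq,
      finrank_indChar s hs hmul hne, hcard,
      card_cosetReps S.one_le_q hm (by omega) hdmn]
  · rintro g ⟨hg, hg1⟩ _ ⟨f, hf, rfl⟩
    rw [← mat_ofMat hg, rho_extendK]
    congr 1
    funext k
    exact hN f hf (ofMat g hg) (by exact_mod_cast hg1) k
  · intro htriv
    obtain ⟨x₀, hx₀, hx₀0, hx₀1⟩ := S.psi'_nontriv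
    have hs0 := S.sqeps_ne_zero
    have hnus : S.nu (S.sqeps * u * S.sqeps) = ((-(d : ℤ) : ℤ) : WithTop ℤ) := by
      rw [S.nu_mul, S.nu_mul, S.nu_sqeps, hnu, add_zero, zero_add]
    let y := (S.sqeps * u * S.sqeps)⁻¹ * x₀
    have hy : S.sig y = y := by
      simp only [y, map_mul, sig_inv, S.sig_sqeps, hu, hx₀]
      congr 2
      ring
    have hyd : S.InP d y := by
      refine InP.mul_right ?_ hx₀0
      rw [InP, nu_inv hnus, neg_neg]
    have hgK : S.lowerRep 1 y ∈ Kset S := lowerRep_mem nu_one hy (hyd.mono (by omega))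
    have hgd : S.MatInP d (S.lowerRep 1 y - 1) := by
      intro i j
      fin_cases i <;> fin_cases j <;> simp [lowerRep, InP.zero, hyd.mul_right InP.sqeps]
    have hgJ : ofMat _ hgK ∈ J := hgd.lat (by omega) (by omega)
    have h1 := congrFun (htriv _ ⟨hgK, hgd⟩ _ ⟨f₀, hf₀, rfl⟩) (mat (1 : S.Kgrp))
    rw [← mat_ofMat hgK, rho_extendK, extendK_mat, extendK_mat, hf₀1, rightTranslate, one_mul] at h1
    simp only [f₀, if_pos (hJH hgJ)] at h1
    refine hx₀1 ?_
    rw [← psiE_of_fixed hx₀, ← h1]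
    change _ = Ψ' (S.lowerRep 1 y)
    rw [hJ _ hgK hgJ, PsiC]
    congr 1
    simp only [Matrix.trace_fin_two, mul_apply_two]
    simp [Xzuv, lowerRep, y]
    field_simp
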